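/- arXiv:2503.15958 — 6 statements merged into one kernel-verified Lean document; each statement's English description precedes it below -/
import Mathlib

section
/- Let ζ be a d-kernel, φ a self-excitation d-kernel and μ measurable baselines. For every horizon T ≥ 0, every integer n ≥ 1, and every tuple of points x₁ = (k₁,t₁,θ₁,y₁), …, xₙ = (kₙ,tₙ,θₙ,yₙ) with 0 < t₁ < ⋯ < tₙ ≤ T, one has 𝒯ⁿ_{(x₁,…,xₙ)} Z^i_T = ζ^{i,kₙ}(T − tₙ, yₙ) · 𝒯^{n−1}_{(x₁,…,x_{n−1})} G, where G is the functional G(ϖ) := 1_{θₙ ≤ λ^{kₙ}_{tₙ}(ϖ)} on finite configurations, for every i ∈ {1,…,d}. (Deterministic recursion (4.2) of Theorem 4.1.) -/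
open MeasureTheory Finset Filter

noncomputable section
namespace MSPD

/-- A marked point `(k, t, θ, y)` of `{1,…,d} × ℝ₊³`. -/
abbrev Point (d : ℕ) := Fin d × ℝ × ℝ × ℝ

variable {d : ℕ}

/-- Auxiliary intensity functional, with fuel `n`. -/
def lamAux (φ : Fin d → Fin d → ℝ → ℝ → ℝ) (μ : Fin d → ℝ → ℝ) :
    ℕ → Finset (Point d) → Fin d → ℝ → ℝ
  | 0, _, i, t => μ i t
  | n + 1, ϖ, i, t => μ i t + ∑ x ∈ ϖ.filter (fun x => x.2.1 < t),
      φ i x.1 (t - x.2.1) x.2.2.2 * (if x.2.2.1 ≤ lamAux φ μ n ϖ x.1 x.2.1 then 1 else 0)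

/-- The intensity functional `λ^i_t(ϖ)`, defined by recursion on the time order of
the points of the finite configuration `ϖ`. -/
def lam (φ : Fin d → Fin d → ℝ → ℝ → ℝ) (μ : Fin d → ℝ → ℝ)
    (ϖ : Finset (Point d)) (i : Fin d) (t : ℝ) : ℝ :=
  lamAux φ μ ϖ.card ϖ i t

/-- The MSPD functional `Z^i_T(ϖ)`. -/
def Zfun (ζ φ : Fin d → Fin d → ℝ → ℝ → ℝ) (μ : Fin d → ℝ → ℝ)
    (T : ℝ) (i : Fin d) (ϖ : Finset (Point d)) : ℝ :=
  ∑ x ∈ ϖ.filter (fun x => x.2.1 ≤ T),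
    ζ i x.1 (T - x.2.1) x.2.2.2 * (if x.2.2.1 ≤ lam φ μ ϖ x.1 x.2.1 then 1 else 0)

/-- The iterated difference operator `𝒯ⁿ_{(x₁,…,xₙ)} F`. -/
def Tdiff (n : ℕ) (xs : Fin n → Point d) (F : Finset (Point d) → ℝ) : ℝ :=
  ∑ J : Finset (Fin n), (-1 : ℝ) ^ (n - J.card) * F (J.image xs)

/-- `ζ` is a d-kernel with respect to the family of mark laws `ν`. -/
def IsKernel (ν : Fin d → Measure ℝ) (ζ : Fin d → Fin d → ℝ → ℝ → ℝ) : Prop :=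
  (∀ i k, Measurable fun p : ℝ × ℝ => ζ i k p.1 p.2) ∧
    (∀ i k t y, 0 ≤ ζ i k t y) ∧ ∀ i k t, Integrable (fun y => ζ i k t y) (ν k)

/-- `φ` is a self-excitation d-kernel: a d-kernel vanishing for nonpositive times. -/
def IsSelfExciting (ν : Fin d → Measure ℝ) (φ : Fin d → Fin d → ℝ → ℝ → ℝ) : Prop :=
  IsKernel ν φ ∧ ∀ i k τ y, τ ≤ 0 → φ i k τ y = 0

/-- `μ` is a family of measurable nonnegative baselines. -/
def IsBaseline (μ : Fin d → ℝ → ℝ) : Prop :=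
  (∀ i, Measurable (μ i)) ∧ ∀ i t, 0 ≤ μ i t

/-- The compatibility condition for a time-ordered tuple of points. -/
def Compatible (φ : Fin d → Fin d → ℝ → ℝ → ℝ) (μ : Fin d → ℝ → ℝ)
    {n : ℕ} (xs : Fin n → Point d) : Prop :=
  ∀ m : Fin n, (xs m).2.2.1 ≤ μ (xs m).1 (xs m).2.1 +
    ∑ j ∈ Finset.Iio m, φ (xs m).1 (xs j).1 ((xs m).2.1 - (xs j).2.1) (xs j).2.2.2

end MSPD
end

open MSPD MeasureTheory

namespace MSPD

variable {d : ℕ}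

/-- The intensity at time `t` only depends on the points strictly before `t`, and the fuel is
irrelevant as soon as it is at least the number of these points. -/
theorem lamAux_congr (φ : Fin d → Fin d → ℝ → ℝ → ℝ) (μ : Fin d → ℝ → ℝ)
    {ϖ ϖ' : Finset (Point d)} (m m' : ℕ) (i : Fin d) (t : ℝ)
    (h : ϖ.filter (fun x => x.2.1 < t) = ϖ'.filter (fun x => x.2.1 < t))
    (hm : (ϖ.filter (fun x => x.2.1 < t)).card ≤ m)
    (hm' : (ϖ.filter (fun x => x.2.1 < t)).card ≤ m') :
    lamAux φ μ m ϖ i t = lamAux φ μ m' ϖ' i t := by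
  induction m generalizing m' i t with
  | zero =>
    have he : ϖ.filter (fun x => x.2.1 < t) = ∅ := Finset.card_eq_zero.mp (Nat.le_zero.mp hm)
    cases m' with
    | zero => rfl
    | succ m' => simp only [lamAux, ← h, he, Finset.sum_empty, add_zero]
  | succ m ih =>
    cases m' with
    | zero =>
      have he : ϖ.filter (fun x => x.2.1 < t) = ∅ := Finset.card_eq_zero.mp (Nat.le_zero.mp hm')
      simp only [lamAux, he, Finset.sum_empty, add_zero]
    | succ m' =>
      simp only [lamAux, ← h]
      congr 1
      refine Finset.sum_congr rfl fun x hx => ?_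
      have hxt : x.2.1 < t := (Finset.mem_filter.mp hx).2
      have hlt : (ϖ.filter (fun z => z.2.1 < x.2.1)).card
          < (ϖ.filter (fun z => z.2.1 < t)).card := by
        refine Finset.card_lt_card (Finset.ssubset_iff_of_subset ?_ |>.mpr ⟨x, hx, by simp⟩)
        exact Finset.monotone_filter_right _ fun z _ hz => lt_trans hz hxt
      have hfil : ϖ.filter (fun z => z.2.1 < x.2.1) = ϖ'.filter (fun z => z.2.1 < x.2.1) := by
        ext z
        have hz := Finset.ext_iff.mp h z
        simp only [Finset.mem_filter] at hz ⊢
        constructor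
        · exact fun hz' => ⟨(hz.mp ⟨hz'.1, hz'.2.trans hxt⟩).1, hz'.2⟩
        · exact fun hz' => ⟨(hz.mpr ⟨hz'.1, hz'.2.trans hxt⟩).1, hz'.2⟩
      rw [ih m' x.1 x.2.1 hfil (by omega) (by omega)]

theorem lam_congr (φ : Fin d → Fin d → ℝ → ℝ → ℝ) (μ : Fin d → ℝ → ℝ)
    {ϖ ϖ' : Finset (Point d)} (i : Fin d) (t : ℝ)
    (h : ϖ.filter (fun x => x.2.1 < t) = ϖ'.filter (fun x => x.2.1 < t)) :
    lam φ μ ϖ i t = lam φ μ ϖ' i t :=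
  lamAux_congr φ μ _ _ i t h (Finset.card_filter_le _ _) (h ▸ Finset.card_filter_le _ _)

theorem lam_insert_of_le (φ : Fin d → Fin d → ℝ → ℝ → ℝ) (μ : Fin d → ℝ → ℝ)
    (ϖ : Finset (Point d)) (x : Point d) (i : Fin d) {t : ℝ} (ht : t ≤ x.2.1) :
    lam φ μ (insert x ϖ) i t = lam φ μ ϖ i t :=
  lam_congr φ μ i t (by rw [Finset.filter_insert, if_neg (not_lt.mpr ht)])

/-- Adding a point later than all points of `ϖ` adds exactly the contribution of that point. -/
theorem Zfun_insert_sub (ζ φ : Fin d → Fin d → ℝ → ℝ → ℝ) (μ : Fin d → ℝ → ℝ) {T : ℝ}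
    (i : Fin d) (ϖ : Finset (Point d)) (x : Point d) (hxT : x.2.1 ≤ T)
    (hϖ : ∀ z ∈ ϖ, z.2.1 < x.2.1) :
    Zfun ζ φ μ T i (insert x ϖ) - Zfun ζ φ μ T i ϖ =
      ζ i x.1 (T - x.2.1) x.2.2.2 * (if x.2.2.1 ≤ lam φ μ ϖ x.1 x.2.1 then 1 else 0) := by
  have hx : x ∉ ϖ.filter (fun z => z.2.1 ≤ T) := fun hx =>
    lt_irrefl _ (hϖ x (Finset.mem_filter.mp hx).1)
  rw [Zfun, Zfun, Finset.filter_insert, if_pos hxT, Finset.sum_insert hx,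
    lam_insert_of_le φ μ ϖ x _ le_rfl, add_sub_assoc, add_eq_left, sub_eq_zero]
  refine Finset.sum_congr rfl fun z hz => ?_
  rw [lam_insert_of_le φ μ ϖ x _ (hϖ z (Finset.mem_filter.mp hz).1).le]

/-- The `(n+1)`-st iterated difference is the `n`-th iterated difference of the difference with
respect to the last point. -/
theorem Tdiff_succ (n : ℕ) (xs : Fin (n + 1) → Point d) (F : Finset (Point d) → ℝ) :
    Tdiff (n + 1) xs F = Tdiff n (fun j => xs j.castSucc)
      (fun ϖ => F (insert (xs (Fin.last n)) ϖ) - F ϖ) := by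
  have hu : (Finset.univ : Finset (Finset (Fin (n + 1)))) =
      (insert (Fin.last n) (Finset.univ.image Fin.castSucc)).powerset := by
    rw [← Finset.powerset_univ]
    congr 1
    ext j
    induction j using Fin.lastCases <;> simp
  have hinj : Function.Injective
      (fun J : Finset (Fin n) => J.image (Fin.castSucc : Fin n → Fin (n + 1))) :=
    Finset.image_injective (Fin.castSucc_injective n)
  have hp : (Finset.univ.image (Fin.castSucc : Fin n → Fin (n + 1))).powerset =
      Finset.univ.image (fun J : Finset (Fin n) => J.image Fin.castSucc) := by
    ext J
    simp only [Finset.mem_powerset, Finset.mem_image, Finset.mem_univ, true_and,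
      Finset.subset_image_iff, Finset.subset_univ]
  have hlast : ∀ J : Finset (Fin n), Fin.last n ∉ J.image Fin.castSucc := by simp
  unfold Tdiff
  rw [hu, Finset.sum_powerset_insert (hlast _), hp,
    Finset.sum_image hinj.injOn, Finset.sum_image hinj.injOn, ← Finset.sum_add_distrib]
  refine Finset.sum_congr rfl fun J _ => ?_
  have hJ : J.card ≤ n := by simpa using J.card_le_univ
  rw [Finset.card_insert_of_notMem (hlast J),
    Finset.card_image_of_injective J (Fin.castSucc_injective n), Finset.image_insert,
    Finset.image_image, Nat.add_sub_add_right, Nat.succ_sub hJ, pow_succ]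
  simp only [Function.comp_def]
  ring

end MSPD

/-- recursion (4.2) of Theorem 4.1: for time-ordered points
`x₀,…,xₙ` with `0 < t₀ < ⋯ < tₙ ≤ T`,
`𝒯^{n+1}_{(x₀,…,xₙ)} Z^i_T = ζ^{i,kₙ}(T−tₙ,yₙ) · 𝒯ⁿ_{(x₀,…,x_{n−1})} 1_{θₙ ≤ λ^{kₙ}_{tₙ}}`. -/
theorem statement0 (d : ℕ) (hd : 1 ≤ d)
    (ν : Fin d → Measure ℝ) [∀ k, IsProbabilityMeasure (ν k)]
    (hν : ∀ k, ν k (Set.Iio 0) = 0)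
    (ζ φ : Fin d → Fin d → ℝ → ℝ → ℝ) (μ : Fin d → ℝ → ℝ)
    (hζ : IsKernel ν ζ) (hφ : IsSelfExciting ν φ) (hμ : IsBaseline μ)
    (T : ℝ) (hT : 0 ≤ T) (n : ℕ) (xs : Fin (n + 1) → Point d)
    (hmono : StrictMono fun j => (xs j).2.1)
    (h0 : 0 < (xs 0).2.1) (hlast : (xs (Fin.last n)).2.1 ≤ T)
    (hθ : ∀ j, 0 ≤ (xs j).2.2.1) (hy : ∀ j, 0 ≤ (xs j).2.2.2)
    (i : Fin d) :
    Tdiff (n + 1) xs (Zfun ζ φ μ T i) =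
      ζ i (xs (Fin.last n)).1 (T - (xs (Fin.last n)).2.1) (xs (Fin.last n)).2.2.2 *
        Tdiff n (fun j => xs j.castSucc)
          (fun ϖ => if (xs (Fin.last n)).2.2.1 ≤
              lam φ μ ϖ (xs (Fin.last n)).1 (xs (Fin.last n)).2.1 then 1 else 0) := by
  rw [Tdiff_succ]
  unfold Tdiff
  rw [Finset.mul_sum]
  refine Finset.sum_congr rfl fun J _ => ?_
  beta_reduce
  rw [Zfun_insert_sub ζ φ μ i _ _ hlast, mul_left_comm]
  intro z hz
  obtain ⟨j, -, rfl⟩ := Finset.mem_image.mp hz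
  exact hmono (Fin.castSucc_lt_last j)
end

section
/- (Compatibility condition.) Let ζ be a d-kernel, φ a self-excitation d-kernel and μ measurable baselines. For every T ≥ 0, every n ≥ 1, and every tuple of points x₁,…,xₙ with 0 < t₁ < ⋯ < tₙ ≤ T, one has, for every i ∈ {1,…,d}: 𝒯ⁿ_{(x₁,…,xₙ)} Z^i_T = 𝒯ⁿ_{(x₁,…,xₙ)} Z^i_T · 1_{θ₁ ≤ μ^{k₁}(t₁)} · ∏_{m=2}^{n} 1_{θ_m ≤ μ^{k_m}(t_m) + Σ_{j=1}^{m−1} φ^{k_m,k_j}(t_m − t_j, y_j)}. In particular 𝒯ⁿ_{(x₁,…,xₙ)} Z^i_T = 0 unless (x₁,…,xₙ) satisfies the compatibility condition. -/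
open MeasureTheory Finset Filter

open MSPD MeasureTheory

namespace MSPD

variable {d : ℕ}

/-- The fuel of `lamAux` is irrelevant once it exceeds the number of earlier points. -/
theorem lamAux_eq_of_card_le (φ : Fin d → Fin d → ℝ → ℝ → ℝ) (μ : Fin d → ℝ → ℝ)
    (ϖ : Finset (Point d)) (n n' : ℕ) (i : Fin d) (t : ℝ)
    (h : #{x ∈ ϖ | x.2.1 < t} ≤ n) (h' : #{x ∈ ϖ | x.2.1 < t} ≤ n') :
    lamAux φ μ n ϖ i t = lamAux φ μ n' ϖ i t := by
  induction n generalizing n' i t with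
  | zero =>
    cases n' with
    | zero => rfl
    | succ n' =>
      have he : ϖ.filter (fun x => x.2.1 < t) = ∅ := card_eq_zero.mp (Nat.le_zero.mp h)
      simp [lamAux, he]
  | succ n ih =>
    cases n' with
    | zero =>
      have he : ϖ.filter (fun x => x.2.1 < t) = ∅ := card_eq_zero.mp (Nat.le_zero.mp h')
      simp [lamAux, he]
    | succ n' =>
      simp only [lamAux]
      congr 1
      refine sum_congr rfl fun x hx => ?_
      have hlt : #{y ∈ ϖ | y.2.1 < x.2.1} < #{y ∈ ϖ | y.2.1 < t} := by
        refine card_lt_card (ssubset_iff_of_subset ?_ |>.mpr ⟨x, hx, by simp⟩)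
        exact monotone_filter_right _ fun y _ hy => hy.trans (mem_filter.mp hx).2
      rw [ih n' x.1 x.2.1 (by omega) (by omega)]

theorem lamAux_le (φ : Fin d → Fin d → ℝ → ℝ → ℝ) (μ : Fin d → ℝ → ℝ)
    (hφ : ∀ i k t y, 0 ≤ φ i k t y) (n : ℕ) (ϖ : Finset (Point d)) (i : Fin d) (t : ℝ) :
    lamAux φ μ n ϖ i t ≤
      μ i t + ∑ x ∈ ϖ with x.2.1 < t, φ i x.1 (t - x.2.1) x.2.2.2 := by
  cases n with
  | zero => simpa [lamAux] using sum_nonneg fun x _ => hφ i x.1 (t - x.2.1) x.2.2.2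
  | succ n =>
    simp only [lamAux]
    gcongr with x
    split_ifs <;> simp [hφ]

/-- A point whose threshold is never reached does not influence the intensity. -/
theorem lamAux_insert (φ : Fin d → Fin d → ℝ → ℝ → ℝ) (μ : Fin d → ℝ → ℝ)
    {ϖ : Finset (Point d)} {p : Point d} (hp : p ∉ ϖ)
    (h : ∀ n, lamAux φ μ n ϖ p.1 p.2.1 < p.2.2.1) (n : ℕ) (i : Fin d) (t : ℝ) :
    lamAux φ μ n (insert p ϖ) i t = lamAux φ μ n ϖ i t := by
  induction n generalizing i t with
  | zero => rfl
  | succ n ih =>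
    simp only [lamAux, ih]
    rw [sum_filter, sum_insert hp, ← sum_filter, if_neg (h n).not_ge]
    simp

theorem lam_insert (φ : Fin d → Fin d → ℝ → ℝ → ℝ) (μ : Fin d → ℝ → ℝ)
    {ϖ : Finset (Point d)} {p : Point d} (hp : p ∉ ϖ)
    (h : ∀ n, lamAux φ μ n ϖ p.1 p.2.1 < p.2.2.1) (i : Fin d) (t : ℝ) :
    lam φ μ (insert p ϖ) i t = lam φ μ ϖ i t := by
  have hc : #{x ∈ ϖ | x.2.1 < t} ≤ #ϖ := card_filter_le _ _
  rw [lam, lam, lamAux_insert φ μ hp h, card_insert_of_notMem hp]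
  exact lamAux_eq_of_card_le φ μ ϖ _ _ i t (by omega) hc

theorem Zfun_insert (ζ φ : Fin d → Fin d → ℝ → ℝ → ℝ) (μ : Fin d → ℝ → ℝ) (T : ℝ) (i : Fin d)
    {ϖ : Finset (Point d)} {p : Point d} (hp : p ∉ ϖ)
    (h : ∀ n, lamAux φ μ n ϖ p.1 p.2.1 < p.2.2.1) :
    Zfun ζ φ μ T i (insert p ϖ) = Zfun ζ φ μ T i ϖ := by
  simp only [Zfun, lam_insert φ μ hp h]
  have hl : ¬ p.2.2.1 ≤ lam φ μ ϖ p.1 p.2.1 := (h _).not_ge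
  rw [sum_filter, sum_insert hp, ← sum_filter, if_neg hl]
  simp

/-- The iterated difference vanishes if the functional ignores one of the points. -/
theorem Tdiff_eq_zero {n : ℕ} (xs : Fin n → Point d) (F : Finset (Point d) → ℝ) (m : Fin n)
    (h : ∀ J : Finset (Fin n), m ∉ J → F (insert (xs m) (J.image xs)) = F (J.image xs)) :
    Tdiff n xs F = 0 := by
  have hm : m ∉ (univ : Finset (Fin n)).erase m := notMem_erase m _
  rw [Tdiff, ← powerset_univ, ← insert_erase (mem_univ m), sum_powerset_insert hm,
    ← sum_add_distrib]
  refine sum_eq_zero fun J hJ => ?_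
  have hmJ : m ∉ J := fun hmem => hm (mem_powerset.mp hJ hmem)
  have hc : #J + 1 ≤ n := by
    simpa [card_insert_of_notMem hmJ] using card_le_univ (insert m J)
  rw [image_insert, h J hmJ, card_insert_of_notMem hmJ,
    show n - #J = n - (#J + 1) + 1 by omega, pow_succ]
  ring

theorem Tdiff_Zfun_eq_zero (ζ φ : Fin d → Fin d → ℝ → ℝ → ℝ) (μ : Fin d → ℝ → ℝ)
    (hφ : ∀ i k t y, 0 ≤ φ i k t y) (T : ℝ) {n : ℕ} (xs : Fin n → Point d)
    (hmono : StrictMono fun j => (xs j).2.1) (i : Fin d) (hc : ¬ Compatible φ μ xs) :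
    Tdiff n xs (Zfun ζ φ μ T i) = 0 := by
  have hinj : Function.Injective xs := fun a b hab =>
    hmono.injective (congrArg (fun x : Point d => x.2.1) hab)
  simp only [Compatible, not_forall, not_le] at hc
  obtain ⟨m, hm⟩ := hc
  refine Tdiff_eq_zero xs _ m fun J hmJ => Zfun_insert ζ φ μ T i ?_ fun k => ?_
  · rwa [hinj.mem_finset_image]
  · refine (lamAux_le φ μ hφ k _ _ _).trans_lt (lt_of_le_of_lt ?_ hm)
    rw [filter_image, sum_image hinj.injOn]
    refine add_le_add le_rfl
      (sum_le_sum_of_subset_of_nonneg (fun j hj => ?_) fun j _ _ => hφ _ _ _ _)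
    exact mem_Iio.mpr (hmono.lt_iff_lt.mp (mem_filter.mp hj).2)

end MSPD

/-- compatibility condition: `𝒯ⁿ_{(x₁,…,xₙ)} Z^i_T` is unchanged when
multiplied by the product of the compatibility indicators; in particular it vanishes
unless `(x₁,…,xₙ)` satisfies the compatibility condition. -/
theorem statement2 (d : ℕ) (hd : 1 ≤ d)
    (ν : Fin d → Measure ℝ) [∀ k, IsProbabilityMeasure (ν k)]
    (hν : ∀ k, ν k (Set.Iio 0) = 0)
    (ζ φ : Fin d → Fin d → ℝ → ℝ → ℝ) (μ : Fin d → ℝ → ℝ)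
    (hζ : IsKernel ν ζ) (hφ : IsSelfExciting ν φ) (hμ : IsBaseline μ)
    (T : ℝ) (hT : 0 ≤ T) (n : ℕ) (hn : 1 ≤ n) (xs : Fin n → Point d)
    (hmono : StrictMono fun j => (xs j).2.1)
    (hts : ∀ j, 0 < (xs j).2.1 ∧ (xs j).2.1 ≤ T)
    (hθ : ∀ j, 0 ≤ (xs j).2.2.1) (hy : ∀ j, 0 ≤ (xs j).2.2.2)
    (i : Fin d) :
    Tdiff n xs (Zfun ζ φ μ T i) =
      Tdiff n xs (Zfun ζ φ μ T i) *
        ∏ m : Fin n, (if (xs m).2.2.1 ≤ μ (xs m).1 (xs m).2.1 +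
            ∑ j ∈ Finset.Iio m,
              φ (xs m).1 (xs j).1 ((xs m).2.1 - (xs j).2.1) (xs j).2.2.2
          then (1 : ℝ) else 0) ∧
    (¬ Compatible φ μ xs → Tdiff n xs (Zfun ζ φ μ T i) = 0) := by
  have hzero := Tdiff_Zfun_eq_zero ζ φ μ hφ.1.2.1 T xs hmono i
  refine ⟨?_, hzero⟩
  by_cases hc : Compatible φ μ xs
  · rw [Finset.prod_eq_one fun m _ => if_pos (hc m), mul_one]
  · rw [hzero hc, zero_mul]
end

section
/- (Volterra resolvent equation; deterministic core of the expectation of the intensity.) Let φ̄ : ℝ₊ → M_d(ℝ) be measurable with nonnegative entries, entrywise integrable, with K := ∫₀^∞ φ̄(t)dt of spectral radius < 1, and let Ψ := Σ_{n≥1} φ̄ₙ. Let μ : ℝ₊ → ℝ₊^d be measurable and locally integrable. Then the function m(T) := μ(T) + ∫₀^T Ψ(T−w) μ(w) dw is locally integrable and satisfies, for almost every T ≥ 0, the Volterra equation m(T) = μ(T) + ∫₀^T φ̄(T−t) m(t) dt. Moreover, if m̃ : ℝ₊ → ℝ₊^d is measurable, locally integrable and satisfies the same equation for almost every T, then m̃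 = m almost everywhere. -/
open MeasureTheory Finset Filter

noncomputable section
namespace MSPD

variable {d : ℕ}

/-- Iterated convolutions `φ̄ₙ` of a matrix-valued kernel (`iterConv φb n = φ̄ₙ` for `n ≥ 1`;
the value at `n = 0` is a dummy). -/
def iterConv (φb : ℝ → Matrix (Fin d) (Fin d) ℝ) :
    ℕ → ℝ → Matrix (Fin d) (Fin d) ℝ
  | 0, _ => 0
  | 1, t => φb t
  | n + 2, t => Matrix.of fun i k =>
      ∑ j, ∫ s in Set.Ioc (0 : ℝ) t, φb (t - s) i j * iterConv φb (n + 1) s j k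

/-- `K := ∫₀^∞ φ̄(t) dt`. -/
def Kmat (φb : ℝ → Matrix (Fin d) (Fin d) ℝ) : Matrix (Fin d) (Fin d) ℝ :=
  Matrix.of fun i k => ∫ t in Set.Ioi (0 : ℝ), φb t i k

/-- `Ψ := Σ_{n ≥ 1} φ̄ₙ` (pointwise sum of the series of iterated convolutions). -/
def psi (φb : ℝ → Matrix (Fin d) (Fin d) ℝ) (t : ℝ) : Matrix (Fin d) (Fin d) ℝ :=
  Matrix.of fun i k => ∑' n : ℕ, iterConv φb (n + 1) t i k

/-- `φ̄` is measurable, with entries nonnegative on `ℝ₊` and integrable on `ℝ₊`. -/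
def KernelBarOK (φb : ℝ → Matrix (Fin d) (Fin d) ℝ) : Prop :=
  (∀ i k, Measurable fun t => φb t i k) ∧
    (∀ i k t, 0 ≤ t → 0 ≤ φb t i k) ∧
    ∀ i k, IntegrableOn (fun t => φb t i k) (Set.Ioi 0)

/-- The spectral radius of `K` (as a complex matrix) is `< 1`. -/
def SpecLT1 (φb : ℝ → Matrix (Fin d) (Fin d) ℝ) : Prop :=
  spectralRadius ℂ ((Kmat φb).map Complex.ofReal) < 1

end MSPD
end

open MSPD MeasureTheory

namespace VolterraResolvent

open Set ENNReal

/-- Convolution product of matrices of nonnegative extended-real-valued functions. -/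
noncomputable def mconv {ι κ l : Type*} [Fintype κ] (A : ι → κ → ℝ → ℝ≥0∞)
    (B : κ → l → ℝ → ℝ≥0∞) (i : ι) (k : l) (t : ℝ) : ℝ≥0∞ :=
  ∑ j, (A i j ⋆ₗ B j k) t

section Convolution

variable {ι κ l o : Type*} [Fintype κ]

theorem measurable_mconv {A : ι → κ → ℝ → ℝ≥0∞} {B : κ → l → ℝ → ℝ≥0∞}
    (hA : ∀ i j, Measurable (A i j)) (hB : ∀ i j, Measurable (B i j)) (i : ι) (k : l) :
    Measurable (mconv A B i k) :=
  Finset.measurable_sum _ fun j _ => measurable_lconvolution volume (hA i j) (hB j k)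

theorem sum_lconvolution {f : κ → ℝ → ℝ≥0∞} (hf : ∀ j, Measurable (f j)) {g : ℝ → ℝ≥0∞}
    (hg : Measurable g) (t : ℝ) :
    ((fun s => ∑ j, f j s) ⋆ₗ g) t = ∑ j, (f j ⋆ₗ g) t := by
  simp only [lconvolution_def, Finset.sum_mul]
  exact lintegral_finsetSum _ fun j _ => by fun_prop

theorem lconvolution_sum {f : κ → ℝ → ℝ≥0∞} (hf : ∀ j, Measurable (f j)) {g : ℝ → ℝ≥0∞}
    (hg : Measurable g) (t : ℝ) :
    (g ⋆ₗ (fun s => ∑ j, f j s)) t = ∑ j, (g ⋆ₗ f j) t := by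
  simp only [lconvolution_def, Finset.mul_sum]
  exact lintegral_finsetSum _ fun j _ => by fun_prop

theorem mconv_assoc [Fintype l] {A : ι → κ → ℝ → ℝ≥0∞} {B : κ → l → ℝ → ℝ≥0∞} {C : l → o → ℝ → ℝ≥0∞}
    (hA : ∀ i j, Measurable (A i j)) (hB : ∀ i j, Measurable (B i j))
    (hC : ∀ i j, Measurable (C i j)) :
    mconv A (mconv B C) = mconv (mconv A B) C := by
  ext i k t
  have h1 : ∀ j, (A i j ⋆ₗ mconv B C j k) t = ∑ m, ((A i j ⋆ₗ B j m) ⋆ₗ C m k) t := by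
    intro j
    refine (lconvolution_sum (fun m => measurable_lconvolution volume (hB j m) (hC m k))
      (hA i j) t).trans ?_
    simp only [lconvolution_assoc (hA i j) (hB j _) (hC _ k)]
  have h2 : ∀ m, (mconv A B i m ⋆ₗ C m k) t = ∑ j, ((A i j ⋆ₗ B j m) ⋆ₗ C m k) t := fun m =>
    sum_lconvolution (fun j => measurable_lconvolution volume (hA i j) (hB j m)) (hC m k) t
  simp only [mconv] at h1 h2 ⊢
  rw [Finset.sum_congr rfl fun j _ => h1 j, Finset.sum_congr rfl fun j _ => h2 j, Finset.sum_comm]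

theorem mconv_add {A : ι → κ → ℝ → ℝ≥0∞} {B C : κ → l → ℝ → ℝ≥0∞}
    (hA : ∀ i j, Measurable (A i j)) (hB : ∀ i j, Measurable (B i j)) :
    mconv A (B + C) = mconv A B + mconv A C := by
  ext i k t
  simp only [mconv, Pi.add_apply, ← Finset.sum_add_distrib, lconvolution_def, mul_add]
  refine Finset.sum_congr rfl fun j _ => lintegral_add_left ?_ _
  have := hA i j
  have := hB j k
  fun_prop

theorem add_mconv {A B : ι → κ → ℝ → ℝ≥0∞} {C : κ → l → ℝ → ℝ≥0∞}
    (hA : ∀ i j, Measurable (A i j)) (hC : ∀ i j, Measurable (C i j)) :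
    mconv (A + B) C = mconv A C + mconv B C := by
  ext i k t
  simp only [mconv, Pi.add_apply, ← Finset.sum_add_distrib, lconvolution_def, add_mul]
  refine Finset.sum_congr rfl fun j _ => lintegral_add_left ?_ _
  have := hA i j
  have := hC j k
  fun_prop

theorem mconv_tsum {A : ι → κ → ℝ → ℝ≥0∞} {B : ℕ → κ → l → ℝ → ℝ≥0∞}
    (hA : ∀ i j, Measurable (A i j)) (hB : ∀ n i j, Measurable (B n i j)) (i : ι) (k : l) (t : ℝ) :
    mconv A (fun i k t => ∑' n, B n i k t) i k t = ∑' n, mconv A (B n) i k t := by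
  simp only [mconv, lconvolution_def, ← ENNReal.tsum_mul_left]
  rw [Summable.tsum_finsetSum fun _ _ => ENNReal.summable]
  refine Finset.sum_congr rfl fun j _ => lintegral_tsum fun n => ?_
  have := hA i j
  have := hB n j k
  fun_prop

theorem tsum_mconv {A : ℕ → ι → κ → ℝ → ℝ≥0∞} {B : κ → l → ℝ → ℝ≥0∞}
    (hA : ∀ n i j, Measurable (A n i j)) (hB : ∀ i j, Measurable (B i j)) (i : ι) (k : l) (t : ℝ) :
    mconv (fun i k t => ∑' n, A n i k t) B i k t = ∑' n, mconv (A n) B i k t := by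
  simp only [mconv, lconvolution_def, ← ENNReal.tsum_mul_right]
  rw [Summable.tsum_finsetSum fun _ _ => ENNReal.summable]
  refine Finset.sum_congr rfl fun j _ => lintegral_tsum fun n => ?_
  have := hA n i j
  have := hB j k
  fun_prop

theorem mconv_congr_ae {A : ι → κ → ℝ → ℝ≥0∞} {B C : κ → l → ℝ → ℝ≥0∞}
    (h : ∀ i j, B i j =ᵐ[volume] C i j) : mconv A B = mconv A C := by
  ext i k t
  refine Finset.sum_congr rfl fun j _ => ?_
  rw [lconvolution_comm (f := A i j), lconvolution_comm (f := A i j)]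
  refine lintegral_congr_ae ?_
  filter_upwards [h j k] with s hs
  rw [hs]

theorem lintegral_lconvolution {f g : ℝ → ℝ≥0∞} (hf : Measurable f) (hg : Measurable g) :
    ∫⁻ t, (f ⋆ₗ g) t = (∫⁻ t, f t) * ∫⁻ t, g t := by
  simp only [lconvolution_def]
  rw [lintegral_lintegral_swap (by fun_prop), ← lintegral_mul_const _ hf]
  refine lintegral_congr fun s => ?_
  rw [lintegral_const_mul _ (by fun_prop), lintegral_add_left_eq_self g (-s)]

end Convolution

/-- A measurable function supported on the half-line, integrable on bounded intervals. -/
structure Causal (A : ℝ → ℝ≥0∞) : Prop where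
  meas : Measurable A
  eq_zero : ∀ t < 0, A t = 0
  loc : ∀ T, ∫⁻ t in Set.Iic T, A t ≠ ∞

namespace Causal

variable {A B : ℝ → ℝ≥0∞}

theorem ae_lt_top (hA : Causal A) : ∀ᵐ t, A t < ∞ := by
  have h : ∀ n : ℕ, ∀ᵐ t, t ∈ Set.Iic (n : ℝ) → A t < ∞ := fun n =>
    (ae_restrict_iff' measurableSet_Iic).1 (MeasureTheory.ae_lt_top hA.meas (hA.loc n))
  filter_upwards [ae_all_iff.2 h] with t ht
  obtain ⟨n, hn⟩ := exists_nat_ge t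
  exact ht n hn

theorem add (hA : Causal A) (hB : Causal B) : Causal (A + B) where
  meas := hA.meas.add hB.meas
  eq_zero t ht := by simp [hA.eq_zero t ht, hB.eq_zero t ht]
  loc T := by
    simp only [Pi.add_apply]
    rw [lintegral_add_left hA.meas]
    exact ENNReal.add_ne_top.2 ⟨hA.loc T, hB.loc T⟩

theorem sum {ι : Type*} [Fintype ι] {A : ι → ℝ → ℝ≥0∞} (hA : ∀ i, Causal (A i)) :
    Causal (fun t => ∑ i, A i t) where
  meas := Finset.measurable_sum _ fun i _ => (hA i).meas
  eq_zero t ht := by simp [(hA _).eq_zero t ht]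
  loc T := by
    rw [lintegral_finsetSum _ fun i _ => (hA i).meas]
    exact ENNReal.sum_ne_top.2 fun i _ => (hA i).loc T

theorem lconvolution_eq (hA : Causal A) (hB : Causal B) (T : ℝ) :
    (A ⋆ₗ B) T = ∫⁻ s in Set.Ioc 0 T, A (T - s) * B s := by
  rw [lconvolution_comm, lconvolution_def, setLIntegral_congr Ioc_ae_eq_Icc,
    ← lintegral_indicator measurableSet_Icc]
  refine lintegral_congr fun s => ?_
  by_cases hs : s ∈ Set.Icc 0 T
  · rw [indicator_of_mem hs, mul_comm, neg_add_eq_sub]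
  · rw [indicator_of_notMem hs]
    rcases lt_or_ge s 0 with h | h
    · simp [hB.eq_zero s h]
    · have : T < s := by
        by_contra! h'
        exact hs ⟨h, h'⟩
      simp [hA.eq_zero (-s + T) (by linarith)]

theorem lconvolution (hA : Causal A) (hB : Causal B) : Causal (A ⋆ₗ B) where
  meas := measurable_lconvolution volume hA.meas hB.meas
  eq_zero t ht := by
    rw [hA.lconvolution_eq hB, Set.Ioc_eq_empty (by linarith)]
    simp
  loc T := by
    have hA' := hA.meas.indicator (measurableSet_Iic (a := T))
    have hB' := hB.meas.indicator (measurableSet_Iic (a := T))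
    have hle : ∀ t, (Set.Iic T).indicator (A ⋆ₗ B) t ≤
        ((Set.Iic T).indicator A ⋆ₗ (Set.Iic T).indicator B) t := by
      intro t
      refine indicator_le' (fun t ht => ?_) (fun _ _ => zero_le) t
      refine lintegral_mono fun s => ?_
      rcases lt_or_ge s 0 with h | h
      · simp [hA.eq_zero s h]
      rcases lt_or_ge (-s + t) 0 with h' | h'
      · simp [hB.eq_zero _ h']
      have ht : t ≤ T := ht
      rw [indicator_of_mem (show s ∈ Set.Iic T from by simp only [Set.mem_Iic]; linarith),
        indicator_of_mem (show -s + t ∈ Set.Iic T from by simp only [Set.mem_Iic]; linarith)]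
    rw [← lintegral_indicator measurableSet_Iic]
    refine ne_top_of_le_ne_top ?_ (lintegral_mono hle)
    rw [lintegral_lconvolution hA' hB', lintegral_indicator measurableSet_Iic,
      lintegral_indicator measurableSet_Iic]
    exact ENNReal.mul_ne_top (hA.loc T) (hB.loc T)

theorem mconv {ι κ l : Type*} [Fintype κ] {A : ι → κ → ℝ → ℝ≥0∞} {B : κ → l → ℝ → ℝ≥0∞}
    (hA : ∀ i j, Causal (A i j)) (hB : ∀ i j, Causal (B i j)) (i : ι) (k : l) :
    Causal (mconv A B i k) :=
  sum fun j => (hA i j).lconvolution (hB j k)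

end Causal

/-- `A` is a causal `ℝ≥0∞`-valued version of the restriction of `a` to the half-line. -/
structure Represents (a : ℝ → ℝ) (A : ℝ → ℝ≥0∞) : Prop extends Causal A where
  eq_toReal : ∀ᵐ t, 0 ≤ t → a t = (A t).toReal

namespace Represents

variable {a b : ℝ → ℝ} {A B : ℝ → ℝ≥0∞}

theorem indicator_ofReal (ha : Measurable a) (h0 : ∀ t, 0 ≤ t → 0 ≤ a t)
    (hloc : LocallyIntegrableOn a (Set.Ici 0)) :
    Represents a ((Set.Ici 0).indicator fun t => ENNReal.ofReal (a t)) where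
  meas := ha.ennreal_ofReal.indicator measurableSet_Ici
  eq_zero t ht := indicator_of_notMem (by simpa using ht) _
  loc T := by
    rw [lintegral_indicator measurableSet_Ici, Measure.restrict_restrict measurableSet_Ici,
      Set.Ici_inter_Iic]
    exact (hloc.integrableOn_compact_subset Set.Icc_subset_Ici_self isCompact_Icc).lintegral_lt_top.ne
  eq_toReal := ae_of_all _ fun t ht => by
    rw [indicator_of_mem (Set.mem_Ici.2 ht), ENNReal.toReal_ofReal (h0 t ht)]

theorem locallyIntegrableOn (h : Represents a A) : LocallyIntegrableOn a (Set.Ici 0) := by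
  rw [locallyIntegrableOn_iff isClosed_Ici.isLocallyClosed]
  intro k hk hkc
  obtain ⟨T, hT⟩ := hkc.bddAbove
  have hint : IntegrableOn (fun t => (A t).toReal) (Set.Iic T) :=
    integrable_toReal_of_lintegral_ne_top h.meas.aemeasurable (h.loc T)
  refine (hint.mono_set fun t ht => hT ht).congr ?_
  filter_upwards [ae_restrict_of_ae h.eq_toReal, ae_restrict_mem hkc.measurableSet] with t ht htk
  exact (ht (hk htk)).symm

theorem add (ha : Represents a A) (hb : Represents b B) :
    Represents (fun t => a t + b t) (A + B) where
  toCausal := ha.toCausal.add hb.toCausal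
  eq_toReal := by
    filter_upwards [ha.eq_toReal, hb.eq_toReal, ha.ae_lt_top, hb.ae_lt_top] with t h1 h2 h3 h4 ht
    rw [h1 ht, h2 ht, Pi.add_apply, ENNReal.toReal_add h3.ne h4.ne]

theorem setIntegral_eq (ha : Represents a A) (hb : Represents b B) (T : ℝ) :
    ∫ s in Set.Ioc 0 T, a (T - s) * b s = ((A ⋆ₗ B) T).toReal := by
  have hq : Measure.QuasiMeasurePreserving (fun s : ℝ => T - s) volume volume :=
    quasiMeasurePreserving_sub_left_of_right_invariant volume T
  have hAm := ha.meas
  have hBm := hb.meas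
  rw [ha.toCausal.lconvolution_eq hb.toCausal, ← integral_toReal (by fun_prop)]
  · refine setIntegral_congr_ae measurableSet_Ioc ?_
    filter_upwards [hq.ae ha.eq_toReal, hb.eq_toReal] with s h1 h2 hs
    rw [h1 (by linarith [hs.2]), h2 hs.1.le, ENNReal.toReal_mul]
  · refine ae_restrict_of_ae ?_
    filter_upwards [hq.ae ha.ae_lt_top, hb.ae_lt_top] with s h1 h2
    exact ENNReal.mul_lt_top h1 h2

theorem mconv {ι κ l : Type*} [Fintype κ] {a : ι → κ → ℝ → ℝ} {b : κ → l → ℝ → ℝ}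
    {A : ι → κ → ℝ → ℝ≥0∞} {B : κ → l → ℝ → ℝ≥0∞}
    (ha : ∀ i j, Represents (a i j) (A i j)) (hb : ∀ i j, Represents (b i j) (B i j))
    (i : ι) (k : l) :
    Represents (fun T => ∑ j, ∫ s in Set.Ioc 0 T, a i j (T - s) * b j k s) (mconv A B i k) where
  toCausal := Causal.mconv (fun i j => (ha i j).toCausal) (fun i j => (hb i j).toCausal) i k
  eq_toReal := by
    have h : ∀ j, Causal (A i j ⋆ₗ B j k) := fun j =>
      (ha i j).toCausal.lconvolution (hb j k).toCausal
    filter_upwards [ae_all_iff.2 fun j => (h j).ae_lt_top] with T hT _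
    rw [VolterraResolvent.mconv, ENNReal.toReal_sum fun j _ => (hT j).ne]
    exact Finset.sum_congr rfl fun j _ => (ha i j).setIntegral_eq (hb j k) T

theorem ae_eq_of_ae_eq (ha : Represents a A) (hb : Represents b B)
    (h : ∀ᵐ t, 0 ≤ t → a t = b t) : A =ᵐ[volume] B := by
  filter_upwards [h, ha.eq_toReal, hb.eq_toReal, ha.ae_lt_top, hb.ae_lt_top] with t h h1 h2 h3 h4
  rcases lt_or_ge t 0 with ht | ht
  · rw [ha.eq_zero t ht, hb.eq_zero t ht]
  · rw [← ENNReal.toReal_eq_toReal_iff' h3.ne h4.ne, ← h1 ht, ← h2 ht, h ht]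

theorem ae_eq (ha : Represents a A) (hb : Represents b B) (h : A =ᵐ[volume] B) :
    ∀ᵐ t, 0 ≤ t → a t = b t := by
  filter_upwards [h, ha.eq_toReal, hb.eq_toReal] with t h h1 h2 ht
  rw [h1 ht, h2 ht, h]

end Represents

section SpectralRadius

variable {ι : Type*} [Fintype ι] [DecidableEq ι]

open scoped Matrix.Norms.Operator in
theorem summable_pow_apply (K : Matrix ι ι ℝ)
    (hK : spectralRadius ℂ (K.map Complex.ofReal) < 1) (i k : ι) :
    Summable fun n : ℕ => (K ^ n) i k := by
  set a : Matrix ι ι ℂ := K.map Complex.ofReal with ha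
  have : CompleteSpace (Matrix ι ι ℂ) := FiniteDimensional.complete ℂ _
  obtain ⟨r, hr, hr1⟩ := exists_between hK
  have hev := (spectrum.pow_nnnorm_pow_one_div_tendsto_nhds_spectralRadius a).eventually_lt_const hr
  lift r to NNReal using hr1.ne_top
  refine Summable.of_norm_bounded_eventually_nat (g := fun n => (r : ℝ) ^ n)
    (summable_geometric_of_lt_one r.2 (by exact_mod_cast hr1)) ?_
  filter_upwards [hev, eventually_gt_atTop 0] with n hn hn0
  have h1 : (‖a ^ n‖₊ : ℝ≥0∞) ≤ (r : ℝ≥0∞) ^ n := by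
    have := ENNReal.rpow_le_rpow hn.le (Nat.cast_nonneg (α := ℝ) n)
    rwa [← ENNReal.rpow_mul, one_div_mul_cancel (by positivity), ENNReal.rpow_one,
      ENNReal.rpow_natCast] at this
  have h2 : ‖a ^ n‖ ≤ (r : ℝ) ^ n := by exact_mod_cast h1
  have h3 : (a ^ n) i k = ((K ^ n) i k : ℝ) := by
    have : a ^ n = (K ^ n).map Complex.ofReal := (Matrix.map_pow K Complex.ofRealHom n).symm
    rw [this, Matrix.map_apply]
  rw [← Complex.norm_real, ← h3]
  refine le_trans ?_ h2
  have h4 : ‖(a ^ n) i k‖₊ ≤ ‖a ^ n‖₊ := by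
    rw [Matrix.linfty_opNNNorm_def]
    exact (Finset.single_le_sum (f := fun j => ‖(a ^ n) i j‖₊) (fun _ _ => zero_le)
      (Finset.mem_univ k)).trans
      (Finset.le_sup (f := fun i => ∑ j, ‖(a ^ n) i j‖₊) (Finset.mem_univ i))
  exact_mod_cast h4

end SpectralRadius

section Resolvent

variable {ι : Type*} [Fintype ι]

/-- Convolution powers, `convPow g n` having `n + 1` factors. -/
noncomputable def convPow (g : ι → ι → ℝ → ℝ≥0∞) : ℕ → ι → ι → ℝ → ℝ≥0∞
  | 0 => g
  | n + 1 => mconv g (convPow g n)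

/-- The sum of all convolution powers. -/
noncomputable def convResolvent (g : ι → ι → ℝ → ℝ≥0∞) (i k : ι) (t : ℝ) : ℝ≥0∞ :=
  ∑' n, convPow g n i k t

variable {g : ι → ι → ℝ → ℝ≥0∞}

theorem measurable_convPow (hg : ∀ i k, Measurable (g i k)) (n : ℕ) (i k : ι) :
    Measurable (convPow g n i k) := by
  induction n generalizing i k with
  | zero => exact hg i k
  | succ n ih => exact measurable_mconv hg ih i k

theorem measurable_convResolvent (hg : ∀ i k, Measurable (g i k)) (i k : ι) :
    Measurable (convResolvent g i k) :=
  Measurable.tsum fun n => measurable_convPow hg n i k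

theorem mconv_convPow_right (hg : ∀ i k, Measurable (g i k)) (n : ℕ) :
    mconv (convPow g n) g = convPow g (n + 1) := by
  induction n with
  | zero => rfl
  | succ n ih =>
    change mconv (mconv g (convPow g n)) g = mconv g (convPow g (n + 1))
    rw [← mconv_assoc hg (measurable_convPow hg n) hg, ih]

theorem convResolvent_eq_add_mconv (hg : ∀ i k, Measurable (g i k)) :
    convResolvent g = g + mconv g (convResolvent g) := by
  ext i k t
  refine (tsum_eq_zero_add' ENNReal.summable).trans ?_
  exact congrArg (g i k t + ·) (mconv_tsum hg (measurable_convPow hg) i k t).symm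

theorem convResolvent_eq_add_mconv' (hg : ∀ i k, Measurable (g i k)) :
    convResolvent g = g + mconv (convResolvent g) g := by
  ext i k t
  refine (tsum_eq_zero_add' ENNReal.summable).trans (congrArg (g i k t + ·) ?_)
  rw [← funext fun n => congrFun₃ (mconv_convPow_right hg n) i k t]
  exact (tsum_mconv (measurable_convPow hg) hg i k t).symm

variable [DecidableEq ι]

theorem lintegral_convPow {K : Matrix ι ι ℝ} (hg : ∀ i k, Measurable (g i k))
    (hK0 : ∀ i k, 0 ≤ K i k) (hK : ∀ i k, ∫⁻ t, g i k t = ENNReal.ofReal (K i k)) (n : ℕ) :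
    ∀ i k, 0 ≤ (K ^ (n + 1)) i k ∧
      ∫⁻ t, convPow g n i k t = ENNReal.ofReal ((K ^ (n + 1)) i k) := by
  induction n with
  | zero => simpa [convPow] using fun i k => ⟨hK0 i k, hK i k⟩
  | succ n ih =>
    intro i k
    have h0 : ∀ j, 0 ≤ K i j * (K ^ (n + 1)) j k := fun j => mul_nonneg (hK0 i j) (ih j k).1
    rw [pow_succ' K (n + 1), Matrix.mul_apply]
    refine ⟨Finset.sum_nonneg fun j _ => h0 j, ?_⟩
    rw [ENNReal.ofReal_sum_of_nonneg fun j _ => h0 j]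
    simp only [convPow, mconv]
    rw [lintegral_finsetSum _ fun j _ =>
      measurable_lconvolution volume (hg i j) (measurable_convPow hg n j k)]
    refine Finset.sum_congr rfl fun j _ => ?_
    rw [lintegral_lconvolution (hg i j) (measurable_convPow hg n j k), hK, (ih j k).2,
      ENNReal.ofReal_mul (hK0 i j)]

theorem lintegral_convResolvent_ne_top {K : Matrix ι ι ℝ} (hg : ∀ i k, Measurable (g i k))
    (hK0 : ∀ i k, 0 ≤ K i k) (hK : ∀ i k, ∫⁻ t, g i k t = ENNReal.ofReal (K i k))
    (hspec : spectralRadius ℂ (K.map Complex.ofReal) < 1) (i k : ι) :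
    ∫⁻ t, convResolvent g i k t ≠ ∞ := by
  have h := lintegral_convPow hg hK0 hK
  simp only [convResolvent]
  rw [lintegral_tsum fun n => (measurable_convPow hg n i k).aemeasurable]
  simp only [(h _ i k).2]
  exact ((summable_nat_add_iff 1).2 (summable_pow_apply K hspec i k)).tsum_ofReal_ne_top

end Resolvent

section Volterra

variable {ι κ : Type*} [Fintype ι] {g : ι → ι → ℝ → ℝ≥0∞} {u N : ι → κ → ℝ → ℝ≥0∞}

theorem mconv_resolvent_eq (hg : ∀ i k, Measurable (g i k)) (hu : ∀ i k, Measurable (u i k)) :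
    mconv g (u + mconv (convResolvent g) u) = mconv (convResolvent g) u := by
  have hP := measurable_convResolvent hg
  rw [mconv_add hg hu, mconv_assoc hg hP hu, ← add_mconv hg hu, ← convResolvent_eq_add_mconv hg]

theorem ae_eq_of_volterra (hg : ∀ i k, Measurable (g i k))
    (hP : ∀ i k, Causal (convResolvent g i k)) (hgc : ∀ i k, Causal (g i k))
    (hu : ∀ i k, Measurable (u i k))
    (hN : ∀ i k, Causal (N i k)) (h : ∀ i k, N i k =ᵐ[volume] (u + mconv g N) i k) (i : ι) (k : κ) :
    N i k =ᵐ[volume] (u + mconv (convResolvent g) u) i k := by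
  have hNm : ∀ i k, Measurable (N i k) := fun i k => (hN i k).meas
  have hPm := measurable_convResolvent hg
  have hgN := Causal.mconv hgc hN
  have h1 : mconv (convResolvent g) N =
      mconv (convResolvent g) u + mconv (convResolvent g) (mconv g N) := by
    rw [mconv_congr_ae h, mconv_add hPm hu]
  have h2 : mconv (convResolvent g) N =
      mconv g N + mconv (convResolvent g) (mconv g N) := by
    rw [mconv_assoc hPm hg hNm, ← add_mconv hg hNm, ← convResolvent_eq_add_mconv' hg]
  filter_upwards [h i k, (Causal.mconv hP hgN i k).ae_lt_top] with t ht hfin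
  have h3 := congrFun₃ (h1.symm.trans h2) i k t
  simp only [Pi.add_apply] at h3 ht ⊢
  rw [ht, (ENNReal.add_left_inj hfin.ne).1 h3]

end Volterra

section Kernel

variable {d : ℕ} {φb : ℝ → Matrix (Fin d) (Fin d) ℝ}

/-- The `ℝ≥0∞`-valued version of the kernel, extended by zero to negative times. -/
noncomputable def kernel (φb : ℝ → Matrix (Fin d) (Fin d) ℝ) (i k : Fin d) : ℝ → ℝ≥0∞ :=
  (Set.Ici 0).indicator fun t => ENNReal.ofReal (φb t i k)

theorem represents_kernel (h : KernelBarOK φb) (i k : Fin d) :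
    Represents (fun t => φb t i k) (kernel φb i k) :=
  .indicator_ofReal (h.1 i k) (h.2.1 i k)
    ((integrableOn_Ici_iff_integrableOn_Ioi).2 (h.2.2 i k)).locallyIntegrableOn

theorem represents_iterConv (h : KernelBarOK φb) (n : ℕ) (i k : Fin d) :
    Represents (fun t => iterConv φb (n + 1) t i k) (convPow (kernel φb) n i k) := by
  induction n generalizing i k with
  | zero => exact represents_kernel h i k
  | succ n ih => exact Represents.mconv (represents_kernel h) ih i k

theorem Kmat_nonneg (h : KernelBarOK φb) (i k : Fin d) : 0 ≤ Kmat φb i k :=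
  setIntegral_nonneg measurableSet_Ioi fun t ht => h.2.1 i k t (Set.mem_Ioi.1 ht).le

theorem lintegral_kernel (h : KernelBarOK φb) (i k : Fin d) :
    ∫⁻ t, kernel φb i k t = ENNReal.ofReal (Kmat φb i k) := by
  rw [kernel, lintegral_indicator measurableSet_Ici, ← setLIntegral_congr Ioi_ae_eq_Ici, Kmat,
    Matrix.of_apply, ofReal_integral_eq_lintegral_ofReal (h.2.2 i k)]
  filter_upwards [ae_restrict_mem measurableSet_Ioi] with t ht
  exact h.2.1 i k t (Set.mem_Ioi.1 ht).le

theorem represents_psi (h : KernelBarOK φb) (hspec : SpecLT1 φb) (i k : Fin d) :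
    Represents (fun t => psi φb t i k) (convResolvent (kernel φb) i k) where
  meas := measurable_convResolvent (fun i k => (represents_kernel h i k).meas) i k
  eq_zero t ht := by simp [convResolvent, (represents_iterConv h _ i k).eq_zero t ht]
  loc T := ne_top_of_le_ne_top (lintegral_convResolvent_ne_top
    (fun i k => (represents_kernel h i k).meas) (Kmat_nonneg h) (lintegral_kernel h) hspec i k)
    (setLIntegral_le_lintegral _ _)
  eq_toReal := by
    filter_upwards [ae_all_iff.2 fun n => (represents_iterConv h n i k).eq_toReal,
      ae_all_iff.2 fun n => (represents_iterConv h n i k).ae_lt_top] with t h1 h2 ht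
    rw [psi, Matrix.of_apply, convResolvent, ENNReal.tsum_toReal_eq fun n => (h2 n).ne]
    exact tsum_congr fun n => h1 n ht

end Kernel

end VolterraResolvent

/-- Volterra resolvent equation: `m(T) := μ(T) + ∫₀^T Ψ(T−w) μ(w) dw`
is locally integrable, satisfies the Volterra equation
`m(T) = μ(T) + ∫₀^T φ̄(T−t) m(t) dt` for a.e. `T ≥ 0`, and is the a.e.-unique
measurable nonnegative locally integrable solution. -/
theorem statement5 (d : ℕ) (hd : 1 ≤ d)
    (φb : ℝ → Matrix (Fin d) (Fin d) ℝ) (hφb : KernelBarOK φb)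
    (hspec : SpecLT1 φb)
    (μv : ℝ → Fin d → ℝ)
    (hμmeas : ∀ i, Measurable fun t => μv t i)
    (hμ0 : ∀ t i, 0 ≤ t → 0 ≤ μv t i)
    (hμint : ∀ i, LocallyIntegrableOn (fun t => μv t i) (Set.Ici 0)) :
    (∀ i, LocallyIntegrableOn
        (fun T => μv T i + ∑ j, ∫ w in Set.Ioc (0 : ℝ) T, psi φb (T - w) i j * μv w j)
        (Set.Ici 0)) ∧
    (∀ᵐ T ∂(volume.restrict (Set.Ici (0 : ℝ))), ∀ i,
        μv T i + ∑ j, ∫ w in Set.Ioc (0 : ℝ) T, psi φb (T - w) i j * μv w j =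
          μv T i + ∑ j, ∫ t in Set.Ioc (0 : ℝ) T, φb (T - t) i j *
            (μv t j + ∑ l, ∫ w in Set.Ioc (0 : ℝ) t, psi φb (t - w) j l * μv w l)) ∧
    (∀ mt : ℝ → Fin d → ℝ,
        (∀ i, Measurable fun t => mt t i) →
        (∀ t i, 0 ≤ t → 0 ≤ mt t i) →
        (∀ i, LocallyIntegrableOn (fun t => mt t i) (Set.Ici 0)) →
        (∀ᵐ T ∂(volume.restrict (Set.Ici (0 : ℝ))), ∀ i,
            mt T i = μv T i + ∑ j, ∫ t in Set.Ioc (0 : ℝ) T, φb (T - t) i j * mt t j) →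
        ∀ᵐ T ∂(volume.restrict (Set.Ici (0 : ℝ))), ∀ i,
          mt T i = μv T i + ∑ j, ∫ w in Set.Ioc (0 : ℝ) T, psi φb (T - w) i j * μv w j) := by
  have hg := VolterraResolvent.represents_kernel hφb
  have hP := VolterraResolvent.represents_psi hφb hspec
  have hgm : ∀ i k, Measurable (VolterraResolvent.kernel φb i k) := fun i k => (hg i k).meas
  have hu : ∀ (i : Fin d) (_ : Unit), VolterraResolvent.Represents (fun t => μv t i) _ :=
    fun i _ => .indicator_ofReal (hμmeas i) (fun t => hμ0 t i) (hμint i)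
  have hm := fun i k => (hu i k).add (VolterraResolvent.Represents.mconv hP hu i k)
  refine ⟨fun i => (hm i ()).locallyIntegrableOn, ?_, ?_⟩
  · have hgm' := fun i k => (hu i k).add (VolterraResolvent.Represents.mconv hg hm i k)
    rw [ae_restrict_iff' measurableSet_Ici]
    have h := ae_all_iff.2 fun i => (hm i ()).ae_eq (hgm' i ()) (ae_of_all _ fun t =>
      congrArg (_ + ·) (congrFun₃
        (VolterraResolvent.mconv_resolvent_eq hgm fun i k => (hu i k).meas) i () t).symm)
    filter_upwards [h] with t ht ht0 i using ht i ht0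
  · intro mt hmt hmt0 hmtint hmteq
    have hN : ∀ (i : Fin d) (_ : Unit), VolterraResolvent.Represents (fun t => mt t i) _ :=
      fun i _ => .indicator_ofReal (hmt i) (fun t => hmt0 t i) (hmtint i)
    rw [ae_restrict_iff' measurableSet_Ici] at hmteq ⊢
    have hgN := fun i k => (hu i k).add (VolterraResolvent.Represents.mconv hg hN i k)
    have h := fun i (k : Unit) => (hN i k).ae_eq_of_ae_eq (hgN i k) (by
      filter_upwards [hmteq] with t ht ht0 using ht ht0 i)
    have h' := ae_all_iff.2 fun i => (hN i ()).ae_eq (hm i ())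
      (VolterraResolvent.ae_eq_of_volterra hgm (fun i k => (hP i k).toCausal)
        (fun i k => (hg i k).toCausal) (fun i k => (hu i k).meas)
        (fun i k => (hN i k).toCausal) h i ())
    filter_upwards [h'] with t ht ht0 i using ht i ht0
end

section
/- If the spectral radius of K is strictly less than 1, then the series Σ_{n≥1} φ̄ₙ converges in L¹(ℝ₊; M_d(ℝ)) to a function Ψ, and ∫₀^∞ Ψ(t) dt = (I − K)^{-1} K = (I − K)^{-1} − I, where I is the d×d identity matrix (in particular I − K is invertible). -/
open MeasureTheory Finset Filter

open MSPD MeasureTheory Filter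

/-- In a complex Banach algebra, the Neumann series of an element of spectral radius `< 1`
converges absolutely. -/
theorem summable_norm_pow_of_spectralRadius_lt_one {A : Type*} [NormedRing A] [NormedAlgebra ℂ A]
    [CompleteSpace A] {a : A} (ha : spectralRadius ℂ a < 1) : Summable fun n : ℕ => ‖a ^ n‖ := by
  obtain ⟨r, har, hr⟩ := ENNReal.lt_iff_exists_nnreal_btwn.mp ha
  have hr1 : r < 1 := by exact_mod_cast hr
  have hev := (spectrum.pow_nnnorm_pow_one_div_tendsto_nhds_spectralRadius a).eventually_lt_const har
  refine Summable.of_norm_bounded_eventually_nat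
    (summable_geometric_of_lt_one r.coe_nonneg (by exact_mod_cast hr1)) ?_
  filter_upwards [hev, eventually_gt_atTop 0] with n hn hn0
  have hn' : (0 : ℝ) < n := by exact_mod_cast hn0
  rw [one_div, ENNReal.rpow_inv_lt_iff hn', ENNReal.rpow_natCast] at hn
  rw [norm_norm]
  exact_mod_cast hn.le

theorem Matrix.summable_pow_of_spectralRadius_lt_one {ι : Type*} [Fintype ι] [DecidableEq ι]
    {K : Matrix ι ι ℝ} (hK : spectralRadius ℂ (K.map Complex.ofReal) < 1) :
    Summable fun n : ℕ => K ^ n := by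
  let _ : NormedRing (Matrix ι ι ℂ) := Matrix.linftyOpNormedRing
  let _ : NormedAlgebra ℂ (Matrix ι ι ℂ) := Matrix.linftyOpNormedAlgebra
  have h : Summable fun n : ℕ => K.map Complex.ofReal ^ n :=
    (summable_norm_pow_of_spectralRadius_lt_one hK).of_norm
  have hpow (n : ℕ) : K.map Complex.ofReal ^ n = (K ^ n).map Complex.ofReal :=
    (map_pow Complex.ofRealHom.mapMatrix K n).symm
  simp only [hpow] at h
  refine Pi.summable.mpr fun i => Pi.summable.mpr fun k => Complex.summable_ofReal.mp ?_
  exact Pi.summable.mp (Pi.summable.mp h i) k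

section L1Series

variable {α E : Type*} [MeasurableSpace α] {μ : Measure α} [NormedAddCommGroup E]
  {F : ℕ → α → E}

theorem tsum_lintegral_enorm_ne_top (hF : ∀ n, Integrable (F n) μ)
    (hsum : Summable fun n => ∫ a, ‖F n a‖ ∂μ) : ∫⁻ a, ∑' n, ‖F n a‖ₑ ∂μ ≠ ⊤ := by
  rw [lintegral_tsum fun n => (hF n).1.enorm]
  simp only [← ofReal_integral_norm_eq_lintegral_enorm (hF _)]
  exact hsum.tsum_ofReal_ne_top

theorem ae_summable_norm_of_summable_integral_norm (hF : ∀ n, Integrable (F n) μ)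
    (hsum : Summable fun n => ∫ a, ‖F n a‖ ∂μ) : ∀ᵐ a ∂μ, Summable fun n => ‖F n a‖ := by
  filter_upwards [ae_lt_top' (AEMeasurable.tsum fun n => (hF n).1.enorm)
    (tsum_lintegral_enorm_ne_top hF hsum)] with a ha
  simpa using ENNReal.summable_toReal ha.ne

theorem integrable_tsum_norm_of_summable_integral_norm (hF : ∀ n, Integrable (F n) μ)
    (hsum : Summable fun n => ∫ a, ‖F n a‖ ∂μ) : Integrable (fun a => ∑' n, ‖F n a‖) μ := by
  have h := integrable_toReal_of_lintegral_ne_top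
    (AEMeasurable.tsum fun n => (hF n).1.enorm) (tsum_lintegral_enorm_ne_top hF hsum)
  simpa [ENNReal.tsum_toReal_eq] using h

variable [CompleteSpace E]

theorem integrable_tsum_of_summable_integral_norm (hF : ∀ n, Integrable (F n) μ)
    (hsum : Summable fun n => ∫ a, ‖F n a‖ ∂μ) : Integrable (fun a => ∑' n, F n a) μ := by
  have hae := ae_summable_norm_of_summable_integral_norm hF hsum
  refine (integrable_tsum_norm_of_summable_integral_norm hF hsum).mono'
    (aestronglyMeasurable_of_tendsto_ae atTop
      (fun N => (integrable_finsetSum (Finset.range N) fun n _ => hF n).1) ?_) ?_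
  · filter_upwards [hae] with a ha
    exact ha.of_norm.hasSum.tendsto_sum_nat
  · filter_upwards [hae] with a ha
    exact norm_tsum_le_tsum_norm ha

theorem tendsto_integral_norm_sum_range_sub_tsum (hF : ∀ n, Integrable (F n) μ)
    (hsum : Summable fun n => ∫ a, ‖F n a‖ ∂μ) :
    Tendsto (fun N => ∫ a, ‖∑ n ∈ Finset.range N, F n a - ∑' n, F n a‖ ∂μ) atTop (nhds 0) := by
  have hae := ae_summable_norm_of_summable_integral_norm hF hsum
  have hint := integrable_tsum_of_summable_integral_norm hF hsum
  have hnorm := integrable_tsum_norm_of_summable_integral_norm hF hsum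
  rw [← integral_zero α ℝ (μ := μ)]
  refine tendsto_integral_of_dominated_convergence _
    (fun N => ((integrable_finsetSum (Finset.range N) fun n _ => hF n).sub hint).1.norm)
    (hnorm.add hnorm) (fun N => ?_) ?_
  · filter_upwards [hae] with a ha
    rw [norm_norm]
    refine (norm_sub_le _ _).trans (add_le_add ?_ (norm_tsum_le_tsum_norm ha))
    exact (norm_sum_le _ _).trans (ha.sum_le_tsum _ fun _ _ => norm_nonneg _)
  · filter_upwards [hae] with a ha
    simpa using (tendsto_sub_nhds_zero_iff.mpr ha.of_norm.hasSum.tendsto_sum_nat).norm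

end L1Series

namespace MSPD

variable {d : ℕ} {φb : ℝ → Matrix (Fin d) (Fin d) ℝ}

theorem KernelBarOK.iterConv_nonneg (hφb : KernelBarOK φb) (n : ℕ) :
    ∀ i k t, 0 ≤ t → 0 ≤ iterConv φb (n + 1) t i k := by
  induction n with
  | zero => exact hφb.2.1
  | succ n ih =>
    intro i k t _
    rw [iterConv, Matrix.of_apply]
    exact Finset.sum_nonneg fun j _ => setIntegral_nonneg measurableSet_Ioc fun s hs =>
      mul_nonneg (hφb.2.1 i j _ (sub_nonneg.mpr hs.2)) (ih j k s hs.1.le)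

/-- The `(n+2)`-nd iterated convolution on `(0, ∞)` as a sum of scalar forward convolutions. -/
theorem iterConv_add_two_apply (n : ℕ) (i k : Fin d) {t : ℝ} (ht : 0 < t) :
    iterConv φb (n + 2) t i k = ∑ j, ∫ s in 0..t, (ContinuousLinearMap.mul ℝ ℝ)
      (iterConv φb (n + 1) s j k) (φb (t - s) i j) := by
  simp [iterConv, intervalIntegral.integral_of_le ht.le, mul_comm]

theorem KernelBarOK.integrableOn_iterConv (hφb : KernelBarOK φb) (n : ℕ) :
    ∀ i k, IntegrableOn (fun t => iterConv φb (n + 1) t i k) (Set.Ioi 0) := by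
  induction n with
  | zero => exact hφb.2.2
  | succ n ih =>
    intro i k
    refine IntegrableOn.congr_fun (integrable_finsetSum Finset.univ fun j _ => ?_)
      (fun t ht => (iterConv_add_two_apply n i k ht).symm) measurableSet_Ioi
    exact (integrable_indicator_iff measurableSet_Ioi).mp
      (integrable_posConvolution (ih j k) (hφb.2.2 i j) (ContinuousLinearMap.mul ℝ ℝ))

theorem KernelBarOK.integral_iterConv (hφb : KernelBarOK φb) (n : ℕ) :
    ∀ i k, ∫ t in Set.Ioi (0 : ℝ), iterConv φb (n + 1) t i k = (Kmat φb ^ (n + 1)) i k := by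
  induction n with
  | zero => simp [Kmat, iterConv]
  | succ n ih =>
    intro i k
    rw [setIntegral_congr_fun measurableSet_Ioi fun t ht => iterConv_add_two_apply n i k ht,
      integral_finsetSum, pow_succ' _ (n + 1), Matrix.mul_apply]
    · refine Finset.sum_congr rfl fun j _ => ?_
      rw [integral_posConvolution (hφb.integrableOn_iterConv n j k) (hφb.2.2 i j), ih,
        ContinuousLinearMap.mul_apply', mul_comm]
      rfl
    · exact fun j _ => (integrable_indicator_iff measurableSet_Ioi).mp
        (integrable_posConvolution (hφb.integrableOn_iterConv n j k) (hφb.2.2 i j)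
          (ContinuousLinearMap.mul ℝ ℝ))

end MSPD

/-- if the spectral radius of `K` is `< 1`, the series `Σ_{n≥1} φ̄ₙ`
converges in `L¹(ℝ₊)` to `Ψ`, `I − K` is invertible, and
`∫₀^∞ Ψ(t) dt = (I−K)⁻¹K = (I−K)⁻¹ − I`. -/
theorem statement8 (d : ℕ) (hd : 1 ≤ d)
    (φb : ℝ → Matrix (Fin d) (Fin d) ℝ) (hφb : KernelBarOK φb)
    (hspec : SpecLT1 φb) :
    (∀ i k, IntegrableOn (fun t => psi φb t i k) (Set.Ioi 0)) ∧
    (∀ i k, Tendsto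
        (fun N => ∫ t in Set.Ioi (0 : ℝ),
          |(∑ n ∈ Finset.range N, iterConv φb (n + 1) t i k) - psi φb t i k|)
        atTop (nhds 0)) ∧
    IsUnit (1 - Kmat φb) ∧
    Matrix.of (fun i k => ∫ t in Set.Ioi (0 : ℝ), psi φb t i k) =
      (1 - Kmat φb)⁻¹ * Kmat φb ∧
    (1 - Kmat φb)⁻¹ * Kmat φb = (1 - Kmat φb)⁻¹ - 1 := by
  have hpow : Summable fun n : ℕ => Kmat φb ^ n :=
    Matrix.summable_pow_of_spectralRadius_lt_one hspec
  have hleft : (1 - Kmat φb) * ∑' n : ℕ, Kmat φb ^ n = 1 := hpow.one_sub_mul_tsum_pow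
  have hunit : IsUnit (1 - Kmat φb) :=
    IsUnit.of_mul_eq_one _ hleft
  have hinv : (1 - Kmat φb)⁻¹ = ∑' n : ℕ, Kmat φb ^ n := Matrix.inv_eq_right_inv hleft
  have hsub : (1 - Kmat φb)⁻¹ * Kmat φb = (1 - Kmat φb)⁻¹ - 1 := by
    have h := Matrix.nonsing_inv_mul _ ((Matrix.isUnit_iff_isUnit_det _).mp hunit)
    rw [mul_sub, mul_one] at h
    exact eq_sub_of_add_eq' (sub_eq_iff_eq_add.mp h).symm
  have hsucc : HasSum (fun n : ℕ => Kmat φb ^ (n + 1)) ((1 - Kmat φb)⁻¹ * Kmat φb) := by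
    rw [hsub, hinv]
    simpa using (hasSum_nat_add_iff' 1).mpr hpow.hasSum
  have hentry (i k : Fin d) : HasSum (fun n : ℕ => (Kmat φb ^ (n + 1)) i k)
      (((1 - Kmat φb)⁻¹ * Kmat φb) i k) := Pi.hasSum.mp (Pi.hasSum.mp hsucc i) k
  have hint (i k : Fin d) (n : ℕ) :
      Integrable (fun t => iterConv φb (n + 1) t i k) (volume.restrict (Set.Ioi 0)) :=
    hφb.integrableOn_iterConv n i k
  have hsum (i k : Fin d) :
      Summable fun n : ℕ => ∫ t in Set.Ioi (0 : ℝ), ‖iterConv φb (n + 1) t i k‖ := by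
    refine (hentry i k).summable.congr fun n => ?_
    rw [← hφb.integral_iterConv]
    exact setIntegral_congr_fun measurableSet_Ioi fun t ht =>
      (Real.norm_of_nonneg (hφb.iterConv_nonneg n i k t (le_of_lt ht))).symm
  refine ⟨fun i k => integrable_tsum_of_summable_integral_norm (hint i k) (hsum i k),
    fun i k => tendsto_integral_norm_sum_range_sub_tsum (hint i k) (hsum i k), hunit, ?_, hsub⟩
  ext i k
  refine (hasSum_integral_of_summable_integral_norm (hint i k) (hsum i k)).unique ?_
  simpa only [hφb.integral_iterConv] using hentry i k
end

section
/- (Monotonicity of the intensity and MSPD functionals under addition of points.) Let ζ be a d-kernel, φ a self-excitation d-kernel and μ measurable baselines. Let ϖ ⊆ ϖ′ be finite configurations (the points of ϖ′ having pairwise distinct times). Then for every i ∈ {1,…,d} and t ≥ 0, λ^i_t(ϖ) ≤ λ^i_t(ϖ′); consequently every point (k_j,t_j,θ_j,y_j) ∈ ϖ with θ_j ≤ λ^{k_j}_{t_j}(ϖ) also satisfies θ_j ≤ λ^{k_j}_{t_j}(ϖ′), and Z^i_T(ϖ) ≤ Z^i_T(ϖ′) for every i and every T ≥ 0. -/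
open MeasureTheory Finset Filter

open MSPD MeasureTheory Finset

/-- The weighted indicator sums defining the functionals are monotone in the configuration and in
the acceptance thresholds. -/
theorem sum_filter_mul_ite_le_sum_filter_mul_ite {ι : Type*} {s s' : Finset ι} (hs : s ⊆ s')
    (p : ι → Prop) [DecidablePred p] {w θ f g : ι → ℝ} (hw : ∀ x, 0 ≤ w x) (hfg : ∀ x, f x ≤ g x) :
    ∑ x ∈ s.filter p, w x * (if θ x ≤ f x then 1 else 0) ≤
      ∑ x ∈ s'.filter p, w x * (if θ x ≤ g x then 1 else 0) := by
  calc ∑ x ∈ s.filter p, w x * (if θ x ≤ f x then 1 else 0)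
      ≤ ∑ x ∈ s.filter p, w x * (if θ x ≤ g x then 1 else 0) := by
        refine Finset.sum_le_sum fun x _ => mul_le_mul_of_nonneg_left ?_ (hw x)
        have := hfg x
        split_ifs <;> linarith
    _ ≤ ∑ x ∈ s'.filter p, w x * (if θ x ≤ g x then 1 else 0) := by
        refine Finset.sum_le_sum_of_subset_of_nonneg (Finset.filter_subset_filter p hs)
          fun x _ _ => mul_nonneg (hw x) ?_
        split_ifs <;> norm_num

/-- The auxiliary intensity is jointly monotone in the fuel and in the configuration. -/
theorem lamAux_mono {d : ℕ} {φ : Fin d → Fin d → ℝ → ℝ → ℝ} (hφ : ∀ i k t y, 0 ≤ φ i k t y)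
    (μ : Fin d → ℝ → ℝ) {ϖ ϖ' : Finset (Point d)} (hsub : ϖ ⊆ ϖ') {n m : ℕ} (hnm : n ≤ m)
    (i : Fin d) (t : ℝ) : lamAux φ μ n ϖ i t ≤ lamAux φ μ m ϖ' i t := by
  induction n generalizing m i t with
  | zero =>
    cases m with
    | zero => exact le_rfl
    | succ m =>
      refine le_add_of_nonneg_right (Finset.sum_nonneg fun x _ => mul_nonneg (hφ _ _ _ _) ?_)
      split_ifs <;> norm_num
  | succ n ih =>
    obtain ⟨m, rfl⟩ : ∃ k, m = k + 1 := ⟨m - 1, by omega⟩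
    simp only [lamAux]
    gcongr _ + ?_
    exact sum_filter_mul_ite_le_sum_filter_mul_ite hsub _ (fun x => hφ _ _ _ _)
      fun x => ih (by omega) _ _

/-- The intensity functional is monotone in the configuration. -/
theorem lam_mono {d : ℕ} {φ : Fin d → Fin d → ℝ → ℝ → ℝ} (hφ : ∀ i k t y, 0 ≤ φ i k t y)
    (μ : Fin d → ℝ → ℝ) {ϖ ϖ' : Finset (Point d)} (hsub : ϖ ⊆ ϖ') (i : Fin d) (t : ℝ) :
    lam φ μ ϖ i t ≤ lam φ μ ϖ' i t :=
  lamAux_mono hφ μ hsub (Finset.card_le_card hsub) i t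

/-- monotonicity under addition of points: if `ϖ ⊆ ϖ′` are finite
configurations (points of `ϖ′` having pairwise distinct times), the intensity is
entrywise monotone, acceptance of points is preserved, and `Z^i_T` is monotone. -/
theorem statement11 (d : ℕ) (hd : 1 ≤ d)
    (ν : Fin d → Measure ℝ) [∀ k, IsProbabilityMeasure (ν k)]
    (hν : ∀ k, ν k (Set.Iio 0) = 0)
    (ζ φ : Fin d → Fin d → ℝ → ℝ → ℝ) (μ : Fin d → ℝ → ℝ)
    (hζ : IsKernel ν ζ) (hφ : IsSelfExciting ν φ) (hμ : IsBaseline μ)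
    (ϖ ϖ' : Finset (Point d)) (hsub : ϖ ⊆ ϖ')
    (hdist : ∀ x ∈ ϖ', ∀ x' ∈ ϖ', x.2.1 = x'.2.1 → x = x')
    (hpos : ∀ x ∈ ϖ', 0 ≤ x.2.1 ∧ 0 ≤ x.2.2.1 ∧ 0 ≤ x.2.2.2) :
    (∀ (i : Fin d) (t : ℝ), 0 ≤ t → lam φ μ ϖ i t ≤ lam φ μ ϖ' i t) ∧
    (∀ x ∈ ϖ, x.2.2.1 ≤ lam φ μ ϖ x.1 x.2.1 → x.2.2.1 ≤ lam φ μ ϖ' x.1 x.2.1) ∧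
    (∀ (i : Fin d) (T : ℝ), 0 ≤ T → Zfun ζ φ μ T i ϖ ≤ Zfun ζ φ μ T i ϖ') := by
  have hlam := lam_mono hφ.1.2.1 μ hsub
  refine ⟨fun i t _ => hlam i t, fun x _ hx => hx.trans (hlam _ _), fun i T _ => ?_⟩
  exact sum_filter_mul_ite_le_sum_filter_mul_ite hsub _ (fun x => hζ.2.1 _ _ _ _)
    fun x => hlam _ _
end

section
/- (Step 1 of the appendix Lemma: θ-integration of the iterated difference operator.) Let ζ be a d-kernel, φ a self-excitation d-kernel and μ measurable baselines. Fix T > 0, n ≥ 1, times 0 < t₁ < ⋯ < tₙ ≤ T, indices k₁,…,kₙ ∈ {1,…,d} and marks y₁,…,yₙ ∈ ℝ₊. Then for every i ∈ {1,…,d}, the function (θ₁,…,θₙ) ↦ 𝒯ⁿ_{(x₁,…,xₙ)} Z^i_T (with xⱼ = (kⱼ,tⱼ,θⱼ,yⱼ)) is integrable on ℝ₊ⁿ and ∫_{ℝ₊ⁿ} 𝒯ⁿ_{(x₁,…,xₙ)} Z^i_T dθ₁ ⋯ dθₙ = ζ^{i,kₙ}(T − tₙ, yₙ) · ∏_{m=2}^{n}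 φ^{k_m,k_{m−1}}(t_m − t_{m−1}, y_{m−1}) · μ^{k₁}(t₁). -/
open MeasureTheory Finset Filter

open MSPD MeasureTheory Finset

noncomputable section
namespace MSPD

/-- The intensity at the `m`-th point of a time-ordered sequence, when only the points with
index in `J` are present: `a` are the baseline values and `W m j` the contribution of an
accepted point `j` to the intensity at `m`. -/
def seqIntensity (a : ℕ → ℝ) (W : ℕ → ℕ → ℝ) (θ : ℕ → ℝ) (J : Finset ℕ) (m : ℕ) : ℝ :=
  a m + ∑ j : Fin m,
    if (j : ℕ) ∈ J ∧ θ j ≤ seqIntensity a W θ J j then W m j else 0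

/-- The sum of the weights `c j` over the accepted points `j < n` with index in `J`. -/
def acceptedSum (a : ℕ → ℝ) (W : ℕ → ℕ → ℝ) (θ : ℕ → ℝ) (n : ℕ) (c : ℕ → ℝ)
    (J : Finset ℕ) : ℝ :=
  ∑ j ∈ range n, if j ∈ J ∧ θ j ≤ seqIntensity a W θ J j then c j else 0

/-- The `n`-th iterated difference of `acceptedSum`. -/
def seqDiff (a : ℕ → ℝ) (W : ℕ → ℕ → ℝ) (n : ℕ) (c : ℕ → ℝ) (θ : ℕ → ℝ) : ℝ :=
  ∑ J ∈ (range n).powerset, (-1 : ℝ) ^ (n - #J) * acceptedSum a W θ n c J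

/-- Extension of a finite tuple by zero. -/
def extendZero {n : ℕ} (θ : Fin n → ℝ) (m : ℕ) : ℝ :=
  if h : m < n then θ ⟨m, h⟩ else 0

section Sequence

variable {a : ℕ → ℝ} {W : ℕ → ℕ → ℝ}

theorem seqIntensity_eq (θ : ℕ → ℝ) (J : Finset ℕ) (m : ℕ) :
    seqIntensity a W θ J m = a m + acceptedSum a W θ m (W m) J := by
  rw [seqIntensity, acceptedSum, Finset.sum_range]

theorem seqIntensity_congr {θ θ' : ℕ → ℝ} {J J' : Finset ℕ} (m : ℕ)
    (hθ : ∀ j < m, θ j = θ' j) (hJ : ∀ j < m, (j ∈ J ↔ j ∈ J')) :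
    seqIntensity a W θ J m = seqIntensity a W θ' J' m := by
  induction m using Nat.strong_induction_on with
  | _ m ih =>
    rw [seqIntensity_eq, seqIntensity_eq, acceptedSum, acceptedSum]
    congr 1
    refine Finset.sum_congr rfl fun j hj => ?_
    have hjm := Finset.mem_range.1 hj
    rw [hθ j hjm, ih j hjm (fun i hi => hθ i (hi.trans hjm)) fun i hi => hJ i (hi.trans hjm)]
    simp only [hJ j hjm]

theorem acceptedSum_congr {θ θ' : ℕ → ℝ} {J J' : Finset ℕ} (n : ℕ) (c : ℕ → ℝ)
    (hθ : ∀ j < n, θ j = θ' j) (hJ : ∀ j < n, (j ∈ J ↔ j ∈ J')) :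
    acceptedSum a W θ n c J = acceptedSum a W θ' n c J' := by
  refine Finset.sum_congr rfl fun j hj => ?_
  have hjn := Finset.mem_range.1 hj
  rw [hθ j hjn, seqIntensity_congr (θ' := θ') (J' := J') j (fun i hi => hθ i (hi.trans hjn))
    fun i hi => hJ i (hi.trans hjn)]
  simp only [hJ j hjn]

theorem seqDiff_succ (n : ℕ) (c : ℕ → ℝ) (θ : ℕ → ℝ) :
    seqDiff a W (n + 1) c θ = c n * ∑ J ∈ (range n).powerset,
      (-1 : ℝ) ^ (n - #J) * if θ n ≤ seqIntensity a W θ J n then 1 else 0 := by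
  rw [seqDiff, Finset.range_add_one, Finset.sum_powerset_insert Finset.notMem_range_self,
    ← Finset.sum_add_distrib, Finset.mul_sum]
  refine Finset.sum_congr rfl fun J hJ => ?_
  have hJ' := Finset.mem_powerset.1 hJ
  have hn : n ∉ J := fun h => Finset.notMem_range_self (hJ' h)
  have hcard : #J ≤ n := by simpa using Finset.card_le_card hJ'
  have hins : ∀ j < n, (j ∈ insert n J ↔ j ∈ J) := fun j hj => by
    simp [hj.ne]
  have h1 : acceptedSum a W θ (n + 1) c J = acceptedSum a W θ n c J := by
    rw [acceptedSum, Finset.sum_range_succ, if_neg (fun h => hn h.1), add_zero, acceptedSum]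
  have h2 : acceptedSum a W θ (n + 1) c (insert n J) = acceptedSum a W θ n c J +
      c n * if θ n ≤ seqIntensity a W θ J n then 1 else 0 := by
    rw [acceptedSum, Finset.sum_range_succ, ← acceptedSum,
      acceptedSum_congr n c (fun _ _ => rfl) hins, seqIntensity_congr n (fun _ _ => rfl) hins]
    simp
  rw [h1, h2, Finset.card_insert_of_notMem hn, Nat.add_sub_add_right,
    show n + 1 - #J = (n - #J) + 1 by omega, pow_succ]
  ring

theorem sum_powerset_range_neg_one_pow (n : ℕ) :
    ∑ J ∈ (range n).powerset, (-1 : ℝ) ^ (n - #J) = if n = 0 then 1 else 0 := by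
  cases n with
  | zero => simp
  | succ n =>
    rw [Finset.range_add_one, Finset.sum_powerset_insert Finset.notMem_range_self,
      ← Finset.sum_add_distrib, if_neg n.succ_ne_zero]
    refine Finset.sum_eq_zero fun J hJ => ?_
    have hJ' := Finset.mem_powerset.1 hJ
    have hcard : #J ≤ n := by simpa using Finset.card_le_card hJ'
    rw [Finset.card_insert_of_notMem fun h => Finset.notMem_range_self (hJ' h),
      Nat.add_sub_add_right, show n + 1 - #J = (n - #J) + 1 by omega, pow_succ]
    ring

theorem sum_powerset_seqIntensity (n : ℕ) (θ : ℕ → ℝ) :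
    ∑ J ∈ (range n).powerset, (-1 : ℝ) ^ (n - #J) * seqIntensity a W θ J n =
      seqDiff a W n (W n) θ + if n = 0 then a 0 else 0 := by
  simp only [seqIntensity_eq, mul_add, Finset.sum_add_distrib, ← Finset.sum_mul,
    sum_powerset_range_neg_one_pow, seqDiff]
  split_ifs with h
  · simp [h, add_comm]
  · simp

theorem seqIntensity_nonneg (ha : ∀ m, 0 ≤ a m) (hW : ∀ m j, 0 ≤ W m j) (θ : ℕ → ℝ)
    (J : Finset ℕ) (m : ℕ) : 0 ≤ seqIntensity a W θ J m := by
  rw [seqIntensity_eq]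
  exact add_nonneg (ha m) (Finset.sum_nonneg fun j _ => by split_ifs <;> simp [hW])

theorem seqIntensity_le (hW : ∀ m j, 0 ≤ W m j) (θ : ℕ → ℝ) (J : Finset ℕ) (m : ℕ) :
    seqIntensity a W θ J m ≤ a m + ∑ j ∈ range m, W m j := by
  rw [seqIntensity_eq]
  gcongr
  exact Finset.sum_le_sum fun j _ => by split_ifs <;> simp [hW]

/-- A point whose threshold exceeds every possible intensity never matters. -/
theorem seqIntensity_insert_of_lt (hW : ∀ m j, 0 ≤ W m j) {θ : ℕ → ℝ} {k : ℕ}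
    (hk : a k + ∑ j ∈ range k, W k j < θ k) (J : Finset ℕ) (m : ℕ) :
    seqIntensity a W θ (insert k J) m = seqIntensity a W θ J m := by
  induction m using Nat.strong_induction_on with
  | _ m ih =>
    rw [seqIntensity_eq, seqIntensity_eq, acceptedSum, acceptedSum]
    congr 1
    refine Finset.sum_congr rfl fun j hj => ?_
    rw [ih j (Finset.mem_range.1 hj)]
    by_cases hjk : j = k
    · subst hjk
      have := (seqIntensity_le hW θ J j).trans_lt hk
      simp [this.not_ge]
    · simp [hjk]

theorem acceptedSum_insert_of_lt (hW : ∀ m j, 0 ≤ W m j) {θ : ℕ → ℝ} {k : ℕ}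
    (hk : a k + ∑ j ∈ range k, W k j < θ k) (n : ℕ) (c : ℕ → ℝ) (J : Finset ℕ) :
    acceptedSum a W θ n c (insert k J) = acceptedSum a W θ n c J := by
  refine Finset.sum_congr rfl fun j _ => ?_
  rw [seqIntensity_insert_of_lt hW hk]
  by_cases hjk : j = k
  · subst hjk
    have := (seqIntensity_le hW θ J j).trans_lt hk
    simp [this.not_ge]
  · simp [hjk]

theorem seqDiff_eq_zero_of_lt (hW : ∀ m j, 0 ≤ W m j) {θ : ℕ → ℝ} {k n : ℕ} (hkn : k < n)
    (hk : a k + ∑ j ∈ range k, W k j < θ k) (c : ℕ → ℝ) :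
    seqDiff a W n c θ = 0 := by
  rw [seqDiff, ← Finset.insert_erase (Finset.mem_range.2 hkn),
    Finset.sum_powerset_insert (Finset.notMem_erase k _), ← Finset.sum_add_distrib]
  refine Finset.sum_eq_zero fun J hJ => ?_
  have hJ' := Finset.mem_powerset.1 hJ
  have hkJ : k ∉ J := fun h => Finset.notMem_erase k _ (hJ' h)
  have hcard : #J ≤ n - 1 := by
    simpa [Finset.card_erase_of_mem (Finset.mem_range.2 hkn)] using Finset.card_le_card hJ'
  rw [acceptedSum_insert_of_lt hW hk, Finset.card_insert_of_notMem hkJ,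
    show n - #J = (n - (#J + 1)) + 1 by omega, pow_succ]
  ring

theorem abs_seqDiff_le (n : ℕ) (c θ : ℕ → ℝ) :
    |seqDiff a W n c θ| ≤ ∑ _J ∈ (range n).powerset, ∑ j ∈ range n, |c j| := by
  refine (Finset.abs_sum_le_sum_abs _ _).trans (Finset.sum_le_sum fun J _ => ?_)
  rw [abs_mul, abs_pow, abs_neg, abs_one, one_pow, one_mul]
  refine (Finset.abs_sum_le_sum_abs _ _).trans (Finset.sum_le_sum fun j _ => ?_)
  split_ifs <;> simp

theorem measurable_seqIntensity (J : Finset ℕ) (m : ℕ) :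
    Measurable fun θ : ℕ → ℝ => seqIntensity a W θ J m := by
  induction m using Nat.strong_induction_on with
  | _ m ih =>
    simp_rw [seqIntensity_eq]
    unfold acceptedSum
    refine measurable_const.add (Finset.measurable_sum _ fun j hj => ?_)
    refine Measurable.ite ?_ measurable_const measurable_const
    exact (MeasurableSet.const _).inter
      (measurableSet_le (measurable_pi_apply j) (ih j (Finset.mem_range.1 hj)))

theorem measurable_seqDiff (n : ℕ) (c : ℕ → ℝ) : Measurable (seqDiff a W n c) := by
  unfold seqDiff acceptedSum
  refine Finset.measurable_sum _ fun J _ => measurable_const.mul ?_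
  refine Finset.measurable_sum _ fun j _ => Measurable.ite ?_ measurable_const measurable_const
  exact (MeasurableSet.const _).inter
    (measurableSet_le (measurable_pi_apply j) (measurable_seqIntensity J j))

@[simp]
theorem extendZero_val {n : ℕ} (θ : Fin n → ℝ) (j : Fin n) : extendZero θ j = θ j := by
  simp [extendZero]

theorem measurable_extendZero (n : ℕ) : Measurable (extendZero : (Fin n → ℝ) → ℕ → ℝ) := by
  refine measurable_pi_iff.2 fun m => ?_
  unfold extendZero
  split_ifs with h
  · exact measurable_pi_apply _
  · exact measurable_const

theorem integrable_seqDiff (hW : ∀ m j, 0 ≤ W m j) (n : ℕ) (c : ℕ → ℝ) :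
    Integrable (fun θ : Fin n → ℝ => seqDiff a W n c (extendZero θ))
      (Measure.pi fun _ => volume.restrict (Set.Ici (0 : ℝ))) := by
  set M : Fin n → ℝ := fun k => a k + ∑ j ∈ range k, W k j
  have hmeas := (measurable_seqDiff (a := a) (W := W) n c).comp (measurable_extendZero n)
  have hs : MeasurableSet (Set.univ.pi fun k => Set.Iic (M k)) :=
    MeasurableSet.univ_pi fun _ => measurableSet_Iic
  rw [← integrableOn_iff_integrable_of_support_subset
    (s := Set.univ.pi fun k => Set.Iic (M k))]
  · refine Measure.integrableOn_of_bounded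
      (M := ∑ _J ∈ (range n).powerset, ∑ j ∈ range n, |c j|) ?_
      hmeas.aestronglyMeasurable (ae_of_all _ fun θ => abs_seqDiff_le n c _)
    rw [Measure.pi_pi]
    refine (ENNReal.prod_lt_top fun k _ => ?_).ne
    rw [Measure.restrict_apply measurableSet_Iic, Set.inter_comm, Set.Ici_inter_Iic]
    exact measure_Icc_lt_top
  · intro θ hθ
    by_contra hmem
    simp only [Set.mem_univ_pi, Set.mem_Iic, not_forall, not_le] at hmem
    obtain ⟨k, hk⟩ := hmem
    exact hθ (seqDiff_eq_zero_of_lt hW k.2 (by simpa [extendZero, M] using hk) c)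

theorem integral_Ici_indicator_le {L : ℝ} (hL : 0 ≤ L) :
    Integrable (fun x : ℝ => if x ≤ L then (1 : ℝ) else 0)
        (volume.restrict (Set.Ici (0 : ℝ))) ∧
      ∫ x in Set.Ici (0 : ℝ), (if x ≤ L then (1 : ℝ) else 0) = L := by
  have h : (fun x : ℝ => if x ≤ L then (1 : ℝ) else 0) = (Set.Iic L).indicator 1 := by
    ext x; simp [Set.indicator_apply]
  have hv : volume.restrict (Set.Ici (0 : ℝ)) (Set.Iic L) = ENNReal.ofReal L := by
    rw [Measure.restrict_apply measurableSet_Iic, Set.inter_comm, Set.Ici_inter_Iic,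
      Real.volume_Icc, sub_zero]
  rw [h]
  constructor
  · rw [integrable_indicator_iff measurableSet_Iic]
    exact integrableOn_const (by simp [hv])
  · rw [integral_indicator_one measurableSet_Iic, Measure.real, hv, ENNReal.toReal_ofReal hL]

theorem integral_seqDiff_succ (ha : ∀ m, 0 ≤ a m) (hW : ∀ m j, 0 ≤ W m j) (n : ℕ)
    (c : ℕ → ℝ) :
    ∫ θ : Fin (n + 1) → ℝ, seqDiff a W (n + 1) c (extendZero θ)
        ∂(Measure.pi fun _ => volume.restrict (Set.Ici (0 : ℝ))) =
      c n * ∫ θ : Fin n → ℝ, (seqDiff a W n (W n) (extendZero θ) + if n = 0 then a 0 else 0)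
        ∂(Measure.pi fun _ => volume.restrict (Set.Ici (0 : ℝ))) := by
  have hmp := (measurePreserving_piFinSuccAbove
    (fun _ : Fin (n + 1) => volume.restrict (Set.Ici (0 : ℝ))) (Fin.last n)).symm
  have hint := (hmp.integrable_comp_emb (MeasurableEquiv.measurableEmbedding _)).2
    (integrable_seqDiff (a := a) hW (n + 1) c)
  rw [← hmp.integral_comp']
  refine (integral_prod_symm _ hint).trans ?_
  simp only [Function.comp_apply]
  rw [← integral_const_mul]
  refine integral_congr_ae (ae_of_all _ fun θ => ?_)
  have hlow (x : ℝ) : ∀ j < n, extendZero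
      ((MeasurableEquiv.piFinSuccAbove (fun _ => ℝ) (Fin.last n)).symm (x, θ)) j =
        extendZero θ j := fun j hj => by
    simp only [extendZero, hj, hj.trans n.lt_succ_self, dif_pos]
    have h := Fin.insertNth_apply_succAbove (α := fun _ => ℝ) (Fin.last n) x θ ⟨j, hj⟩
    rwa [Fin.succAbove_last] at h
  have hlast (x : ℝ) : extendZero
      ((MeasurableEquiv.piFinSuccAbove (fun _ => ℝ) (Fin.last n)).symm (x, θ)) n = x := by
    simp only [extendZero, n.lt_succ_self, dif_pos]
    exact Fin.insertNth_apply_same (α := fun _ => ℝ) (Fin.last n) x θ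
  have hL (J : Finset ℕ) := integral_Ici_indicator_le
    (seqIntensity_nonneg ha hW (extendZero θ) J n)
  simp only [seqDiff_succ, hlast,
    fun x J => seqIntensity_congr (a := a) (W := W) (J := J) n (hlow x) fun _ _ => Iff.rfl]
  rw [integral_const_mul, integral_finsetSum _ fun J _ => (hL J).1.const_mul _]
  simp only [integral_const_mul, (hL _).2, sum_powerset_seqIntensity]

theorem integral_seqDiff (ha : ∀ m, 0 ≤ a m) (hW : ∀ m j, 0 ≤ W m j) (n : ℕ)
    (c : ℕ → ℝ) :
    ∫ θ : Fin (n + 1) → ℝ, seqDiff a W (n + 1) c (extendZero θ)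
        ∂(Measure.pi fun _ => volume.restrict (Set.Ici (0 : ℝ))) =
      c n * (∏ j ∈ range n, W (j + 1) j) * a 0 := by
  induction n generalizing c with
  | zero =>
    rw [integral_seqDiff_succ ha hW]
    rw [Measure.pi_of_empty]
    simp [seqDiff, acceptedSum]
  | succ n ih =>
    rw [integral_seqDiff_succ ha hW]
    simp only [n.succ_ne_zero, if_false, add_zero]
    rw [ih, Finset.prod_range_succ]
    ring

end Sequence

section Points

variable {d n : ℕ} (ζ φ : Fin d → Fin d → ℝ → ℝ → ℝ) (μ : Fin d → ℝ → ℝ)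
  (ks : Fin (n + 1) → Fin d) (ts ys : Fin (n + 1) → ℝ)

/-- The baseline values at a finite sequence of points. -/
def seqBaseline (m : ℕ) : ℝ := μ (ks (Fin.ofNat (n + 1) m)) (ts (Fin.ofNat (n + 1) m))

/-- The contribution of the point `j` of a finite sequence to the intensity at `m`. -/
def seqWeight (m j : ℕ) : ℝ :=
  φ (ks (Fin.ofNat (n + 1) m)) (ks (Fin.ofNat (n + 1) j))
    (ts (Fin.ofNat (n + 1) m) - ts (Fin.ofNat (n + 1) j)) (ys (Fin.ofNat (n + 1) j))

/-- The contribution of the point `j` of a finite sequence to the functional `Z^i_T`. -/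
def seqFinalWeight (T : ℝ) (i : Fin d) (j : ℕ) : ℝ :=
  ζ i (ks (Fin.ofNat (n + 1) j)) (T - ts (Fin.ofNat (n + 1) j)) (ys (Fin.ofNat (n + 1) j))

variable {ks ts ys}

theorem sum_filter_val_lt_eq_sum_range {n : ℕ} (J : Finset (Fin n)) (N : ℕ) (c : Fin n → ℝ)
    (c' : ℕ → ℝ) (hc : ∀ j ∈ J, (j : ℕ) < N → c j = c' j) :
    ∑ j ∈ J with j.val < N, c j =
      ∑ j ∈ range N, if j ∈ J.map Fin.valEmbedding then c' j else 0 := by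
  rw [← Finset.sum_filter]
  refine Finset.sum_bij (fun j _ => (j : ℕ)) ?_ (fun i _ j _ h => Fin.ext h) ?_ ?_
  · intro j hj
    simp only [Finset.mem_filter, Finset.mem_range] at hj ⊢
    exact ⟨hj.2, Finset.mem_map_of_mem Fin.valEmbedding hj.1⟩
  · intro j hj
    simp only [Finset.mem_filter, Finset.mem_range, Finset.mem_map] at hj
    obtain ⟨hjm, i, hi, rfl⟩ := hj
    exact ⟨i, by simpa [hi] using hjm, rfl⟩
  · intro j hj
    simp only [Finset.mem_filter] at hj
    exact hc j hj.1 hj.2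

theorem injective_points (hts : StrictMono ts) (θ : Fin (n + 1) → ℝ) :
    Function.Injective fun j => (ks j, ts j, θ j, ys j) := fun i j h =>
  hts.injective (by simpa using congrArg (fun x => x.2.1) h)

theorem lamAux_image_eq_seqIntensity (hts : StrictMono ts) (θ : Fin (n + 1) → ℝ)
    (J : Finset (Fin (n + 1))) (N : ℕ) (m : Fin (n + 1)) (hm : #(J.filter (· < m)) ≤ N) :
    lamAux φ μ N (J.image fun j => (ks j, ts j, θ j, ys j)) (ks m) (ts m) =
      seqIntensity (seqBaseline μ ks ts) (seqWeight φ ks ts ys) (extendZero θ)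
        (J.map Fin.valEmbedding) m := by
  induction N generalizing m with
  | zero =>
    rw [seqIntensity_eq, lamAux]
    have hE : ∀ j ∈ J, ¬ j < m := by
      simpa [Finset.filter_eq_empty_iff] using hm
    have h0 : acceptedSum (seqBaseline μ ks ts) (seqWeight φ ks ts ys) (extendZero θ) m
        (seqWeight φ ks ts ys m) (J.map Fin.valEmbedding) = 0 := by
      refine Finset.sum_eq_zero fun j hj => if_neg ?_
      rintro ⟨hjJ, -⟩
      obtain ⟨i, hi, rfl⟩ := Finset.mem_map.1 hjJ
      exact hE i hi (by simpa using hj)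
    rw [h0, add_zero, seqBaseline]
    simp
  | succ N ih =>
    rw [seqIntensity_eq, lamAux, acceptedSum, Finset.filter_image,
      Finset.sum_image (injective_points hts θ).injOn]
    simp only [hts.lt_iff_lt, ite_and]
    congr 1
    · simp [seqBaseline]
    refine sum_filter_val_lt_eq_sum_range J m _ _ fun j hj hjm => ?_
    rw [Fin.val_fin_lt] at hjm
    have hlt : #(J.filter (· < j)) < #(J.filter (· < m)) := by
      refine Finset.card_lt_card (Finset.ssubset_iff_of_subset ?_ |>.2 ⟨j, by simp [hj, hjm]⟩)
      intro i hi
      simp only [Finset.mem_filter] at hi ⊢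
      exact ⟨hi.1, hi.2.trans hjm⟩
    rw [ih j (by omega)]
    simp [seqWeight]

theorem Zfun_image_eq_acceptedSum (hts : StrictMono ts) {T : ℝ}
    (hlast : ts (Fin.last n) ≤ T) (i : Fin d) (θ : Fin (n + 1) → ℝ)
    (J : Finset (Fin (n + 1))) :
    Zfun ζ φ μ T i (J.image fun j => (ks j, ts j, θ j, ys j)) =
      acceptedSum (seqBaseline μ ks ts) (seqWeight φ ks ts ys) (extendZero θ) (n + 1)
        (seqFinalWeight ζ ks ts ys T i) (J.map Fin.valEmbedding) := by
  rw [Zfun, acceptedSum, Finset.filter_image,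
    Finset.sum_image (injective_points hts θ).injOn]
  simp only [ite_and]
  rw [← sum_filter_val_lt_eq_sum_range J (n + 1) _ _ fun j _ _ => rfl]
  refine Finset.sum_congr ?_ fun j hj => ?_
  · ext j
    simp [(hts.monotone (Fin.le_last j)).trans hlast, j.is_le]
  · rw [lam, lamAux_image_eq_seqIntensity φ μ hts θ J _ j]
    · simp [seqFinalWeight]
    · rw [Finset.card_image_of_injective _ (injective_points hts θ)]
      exact Finset.card_filter_le _ _

theorem Tdiff_Zfun_eq_seqDiff (hts : StrictMono ts) {T : ℝ}
    (hlast : ts (Fin.last n) ≤ T) (i : Fin d) (θ : Fin (n + 1) → ℝ) :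
    Tdiff (n + 1) (fun j => (ks j, ts j, θ j, ys j)) (Zfun ζ φ μ T i) =
      seqDiff (seqBaseline μ ks ts) (seqWeight φ ks ts ys) (n + 1)
        (seqFinalWeight ζ ks ts ys T i) (extendZero θ) := by
  rw [Tdiff, seqDiff]
  refine Finset.sum_bij (fun J _ => J.map Fin.valEmbedding) ?_ ?_ ?_ ?_
  · intro J _
    rw [Finset.mem_powerset]
    intro j hj
    obtain ⟨i, -, rfl⟩ := Finset.mem_map.1 hj
    exact Finset.mem_range.2 i.2
  · intro J _ J' _ h
    exact Finset.map_injective _ h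
  · intro J hJ
    refine ⟨univ.filter fun j => j.val ∈ J, Finset.mem_univ _, ?_⟩
    ext j
    simp only [Finset.mem_map, Finset.mem_filter, Finset.mem_univ, true_and]
    constructor
    · rintro ⟨i, hi, rfl⟩
      exact hi
    · intro hj
      exact ⟨⟨j, Finset.mem_range.1 (Finset.mem_powerset.1 hJ hj)⟩, hj, rfl⟩
  · intro J _
    rw [Zfun_image_eq_acceptedSum ζ φ μ hts hlast, Finset.card_map]

end Points

end MSPD
end

/-- Step 1 of the appendix Lemma: θ-integration: for fixed ordered
times `0 < t₀ < ⋯ < tₙ ≤ T`, indices and marks, the function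
`(θ₀,…,θₙ) ↦ 𝒯^{n+1} Z^i_T` is integrable on `ℝ₊^{n+1}` and its integral equals
`ζ^{i,kₙ}(T−tₙ,yₙ) · ∏ φ^{k_{m},k_{m−1}}(t_m−t_{m−1},y_{m−1}) · μ^{k₀}(t₀)`. -/
theorem statement13 (d : ℕ) (hd : 1 ≤ d)
    (ν : Fin d → Measure ℝ) [∀ k, IsProbabilityMeasure (ν k)]
    (hν : ∀ k, ν k (Set.Iio 0) = 0)
    (ζ φ : Fin d → Fin d → ℝ → ℝ → ℝ) (μ : Fin d → ℝ → ℝ)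
    (hζ : IsKernel ν ζ) (hφ : IsSelfExciting ν φ) (hμ : IsBaseline μ)
    (T : ℝ) (hT : 0 < T) (n : ℕ)
    (ks : Fin (n + 1) → Fin d) (ts ys : Fin (n + 1) → ℝ)
    (hmono : StrictMono ts) (h0 : 0 < ts 0) (hlast : ts (Fin.last n) ≤ T)
    (hy : ∀ j, 0 ≤ ys j) (i : Fin d) :
    Integrable
      (fun θs : Fin (n + 1) → ℝ =>
        Tdiff (n + 1) (fun j => (ks j, ts j, θs j, ys j)) (Zfun ζ φ μ T i))
      (Measure.pi fun _ => volume.restrict (Set.Ici (0 : ℝ))) ∧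
    ∫ θs : Fin (n + 1) → ℝ,
        Tdiff (n + 1) (fun j => (ks j, ts j, θs j, ys j)) (Zfun ζ φ μ T i)
        ∂(Measure.pi fun _ => volume.restrict (Set.Ici (0 : ℝ))) =
      ζ i (ks (Fin.last n)) (T - ts (Fin.last n)) (ys (Fin.last n)) *
        (∏ j : Fin n,
          φ (ks j.succ) (ks j.castSucc) (ts j.succ - ts j.castSucc) (ys j.castSucc)) *
        μ (ks 0) (ts 0) := by
  have ha : ∀ m, 0 ≤ seqBaseline μ ks ts m := fun m => hμ.2 _ _
  have hW : ∀ m j, 0 ≤ seqWeight φ ks ts ys m j := fun m j => hφ.1.2.1 _ _ _ _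
  simp only [Tdiff_Zfun_eq_seqDiff ζ φ μ hmono hlast]
  refine ⟨integrable_seqDiff hW _ _, ?_⟩
  rw [integral_seqDiff ha hW, Finset.prod_range]
  have hn : Fin.ofNat (n + 1) n = Fin.last n := by ext; simp
  have hcast (j : Fin n) : Fin.ofNat (n + 1) j = j.castSucc := by
    ext; simp
  have hsucc (j : Fin n) : Fin.ofNat (n + 1) (j + 1) = j.succ := by
    ext; simp [Nat.mod_eq_of_lt (Nat.succ_lt_succ j.2)]
  have hzero : Fin.ofNat (n + 1) 0 = 0 := rfl
  simp only [seqFinalWeight, seqWeight, seqBaseline, hn, hcast, hsucc, hzero]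
end
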